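/- Let H be an N×N hermitian Wigner matrix satisfying condition C1, let κ > 0 and fix an energy E ∈ [−2+κ, 2−κ]. Let λ_α denote the largest eigenvalue of H below E (assuming such an eigenvalue exists and α ≤ N−1), and let λ_{α+1} be the next eigenvalue above it. Then there are positive constants C and c, depending on κ, such that P( λ_{α+1} − E ≥ K/N and α ≤ N−1 ) ≤ C e^{−c√K} for any N ≥ 1 and any K ≥ 0. -/

import Mathlib

open MeasureTheory ProbabilityTheory
open scoped ENNReal NNReal

noncomputable section

/-- The density of the Wigner semicircle law. -/
def rhoSC (x : ℝ) : ℝ := if |x| ≤ 2 then Real.sqrt (4 - x ^ 2) / (2 * Real.pi) else 0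

/-- The Stieltjes transform of the Wigner semicircle law. -/
def mSC (z : ℂ) : ℂ := ∫ x : ℝ, (rhoSC x : ℂ) / ((x : ℂ) - z)

/-- The Stieltjes transform of the empirical eigenvalue distribution of a matrix:
`m(z) = N⁻¹ Tr (H - z)⁻¹`. -/
def stTrans {N : ℕ} (A : Matrix (Fin N) (Fin N) ℂ) (z : ℂ) : ℂ :=
  (Matrix.trace (A - z • (1 : Matrix (Fin N) (Fin N) ℂ))⁻¹) / (N : ℂ)

open scoped Classical in
/-- The number of eigenvalues (with multiplicity) of a Hermitian matrix lying in a set `I`. -/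
def eigCount {N : ℕ} {A : Matrix (Fin N) (Fin N) ℂ} (hA : A.IsHermitian) (I : Set ℝ) : ℕ :=
  (Finset.univ.filter fun i => hA.eigenvalues i ∈ I).card

/-- `ν` has a strictly positive density `h` on `ℝ² ≃ ℂ` which is either a product of two copies
of a one-variable function or radially symmetric. -/
def WignerDensityOf (ν : Measure ℂ) (h : ℝ → ℝ → ℝ) : Prop :=
  (∀ x y, 0 < h x y) ∧
  ν = (volume : Measure ℂ).withDensity (fun z => ENNReal.ofReal (h z.re z.im)) ∧
  ((∃ hs : ℝ → ℝ, ∀ x y, h x y = hs x * hs y) ∨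
   (∃ hs : ℝ → ℝ, ∀ x y, h x y = hs (x ^ 2 + y ^ 2)))

/-- Condition C1, with explicit constants: Gaussian moments of the off-diagonal law `ν`
and of the diagonal law `ν'` are bounded by `D` resp. `D'`. -/
def CondC1 (ν : Measure ℂ) (ν' : Measure ℝ) (δ₀ D D' : ℝ) : Prop :=
  0 < δ₀ ∧
  (∫⁻ z, ENNReal.ofReal (Real.exp (δ₀ * ‖z‖ ^ 2)) ∂ν) ≤ ENNReal.ofReal D ∧
  (∫⁻ x, ENNReal.ofReal (Real.exp (δ₀ * x ^ 2)) ∂ν') ≤ ENNReal.ofReal D'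

/-- `H` is an `N × N` hermitian Wigner ensemble on the probability space `(Ω, P)`:
the entries above the diagonal are i.i.d. with law `N^{-1/2} ν` where `ν` has mean zero,
variance one and a density as in `WignerDensityOf`; the diagonal entries are real i.i.d.
with law `N^{-1/2} ν'`, `ν'` of mean zero; and all these entries are independent. -/
structure IsWignerMatrix {Ω : Type} [MeasurableSpace Ω] (P : Measure Ω) (N : ℕ)
    (H : Ω → Matrix (Fin N) (Fin N) ℂ) (ν : Measure ℂ) (ν' : Measure ℝ) : Prop where
  herm : ∀ ω, (H ω).IsHermitian
  prob : IsProbabilityMeasure P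
  probν : IsProbabilityMeasure ν
  probν' : IsProbabilityMeasure ν'
  density : ∃ h, WignerDensityOf ν h
  mean : (∫ z, z ∂ν) = 0
  var : (∫ z, ‖z‖ ^ 2 ∂ν) = 1
  mean' : (∫ x, x ∂ν') = 0
  offdiag : ∀ i j : Fin N, i < j →
    P.map (fun ω => (Real.sqrt N : ℂ) * H ω i j) = ν
  diag : ∀ i : Fin N, P.map (fun ω => Real.sqrt N * (H ω i i).re) = ν'
  diag_real : ∀ ω i, (H ω i i).im = 0
  indep : iIndepFun
    (fun (p : {p : Fin N × Fin N // p.1 ≤ p.2}) (ω : Ω) => H ω p.1.1 p.1.2) P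
/-- The Fourier transform on `ℝ²` of a real function of two variables. -/
def fourier2 (f : ℝ → ℝ → ℝ) (t s : ℝ) : ℂ :=
  ∫ x : ℝ, ∫ y : ℝ, Complex.exp (-Complex.I * (t * x + s * y)) * (f x y : ℂ)

/-- The Laplacian of a function of two real variables. -/
def laplacian2 (g : ℝ → ℝ → ℝ) (x y : ℝ) : ℝ :=
  deriv (deriv (fun t => g t y)) x + deriv (deriv (fun t => g x t)) y

/-- Condition C2 with exponent `a` and constants `w`, `w'`: decay of the Fourier transforms
of the density `h` and of `h · Δ(-log h)`. -/
def CondC2 (h : ℝ → ℝ → ℝ) (a : ℕ) (w w' : ℝ) : Prop :=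
  0 < w ∧ 0 < w' ∧
  (∀ t s : ℝ, ‖fourier2 h t s‖ ≤ 1 / (1 + w * (t ^ 2 + s ^ 2)) ^ a) ∧
  (∀ t s : ℝ, ‖fourier2
      (fun x y => h x y * laplacian2 (fun u v => -Real.log (h u v)) x y) t s‖
    ≤ 1 / (1 + w' * (t ^ 2 + s ^ 2)) ^ a)

/-- Either the real and imaginary parts under `ν` are i.i.d., or `ν` is rotationally
symmetric. -/
def ComplexSymm (ν : Measure ℂ) : Prop :=
  (∃ μ₀ : Measure ℝ,
    ν = Measure.map (fun p : ℝ × ℝ => (p.1 : ℂ) + p.2 * Complex.I) (μ₀.prod μ₀)) ∨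
  (∀ θ : ℝ, Measure.map (fun z => Complex.exp (θ * Complex.I) * z) ν = ν)

noncomputable section
open Matrix Finset

namespace WG

/-- spectral representation data -/
theorem spec {n : Type*} [Fintype n] [DecidableEq n] {A : Matrix n n ℂ} (hA : A.IsHermitian) :
    ∃ U : Matrix n n ℂ, U * Uᴴ = 1 ∧ Uᴴ * U = 1 ∧
      A = U * diagonal (fun a => (hA.eigenvalues a : ℂ)) * Uᴴ := by
  refine ⟨hA.eigenvectorUnitary, ?_, ?_, ?_⟩
  · exact Unitary.mul_star_self_of_mem hA.eigenvectorUnitary.2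
  · exact Unitary.star_mul_self_of_mem hA.eigenvectorUnitary.2
  · conv_lhs => rw [hA.spectral_theorem]
    rfl

def Rz {n : Type*} [Fintype n] [DecidableEq n] (A : Matrix n n ℂ) (z : ℂ) : Matrix n n ℂ :=
  (A - z • (1 : Matrix n n ℂ))⁻¹

theorem lam_sub_ne (l : ℝ) {z : ℂ} (hz : 0 < z.im) : (l : ℂ) - z ≠ 0 := by
  intro h
  have := congrArg Complex.im h
  simp at this; linarith

theorem Rz_spec {n : Type*} [Fintype n] [DecidableEq n] {A : Matrix n n ℂ} (hA : A.IsHermitian) :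
    ∃ U : Matrix n n ℂ, U * Uᴴ = 1 ∧ Uᴴ * U = 1 ∧
      (∀ z : ℂ, 0 < z.im → IsUnit (A - z • (1 : Matrix n n ℂ)).det ∧
      Rz A z = U * diagonal (fun a => ((hA.eigenvalues a : ℂ) - z)⁻¹) * Uᴴ) ∧
      A = U * diagonal (fun a => (hA.eigenvalues a : ℂ)) * Uᴴ := by
  obtain ⟨U, h1, h2, h3⟩ := spec hA
  refine ⟨U, h1, h2, ?_, h3⟩
  intro z hz
  have e1 : A - z • (1 : Matrix n n ℂ) = U * diagonal (fun a => (hA.eigenvalues a : ℂ) - z) * Uᴴ := by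
    have : (diagonal (fun a => (hA.eigenvalues a : ℂ) - z) : Matrix n n ℂ)
       = diagonal (fun a => (hA.eigenvalues a : ℂ)) - z • (1 : Matrix n n ℂ) := by
      ext i j; by_cases h : i = j <;> simp [h]
    rw [this, Matrix.mul_sub, Matrix.sub_mul, ← h3]
    simp [h1]
  have e2 : (A - z • (1 : Matrix n n ℂ)) * (U * diagonal (fun a => ((hA.eigenvalues a : ℂ) - z)⁻¹) * Uᴴ) = 1 := by
    rw [e1]
    calc _ = U * diagonal (fun a => (hA.eigenvalues a : ℂ) - z) * (Uᴴ * U) *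
        diagonal (fun a => ((hA.eigenvalues a : ℂ) - z)⁻¹) * Uᴴ := by simp only [Matrix.mul_assoc]
      _ = 1 := by
        rw [h2, Matrix.mul_one, Matrix.mul_assoc U, diagonal_mul_diagonal]
        have : (fun i => ((hA.eigenvalues i : ℂ) - z) * ((hA.eigenvalues i : ℂ) - z)⁻¹) = fun _ => 1 := by
          funext i; exact mul_inv_cancel₀ (lam_sub_ne _ hz)
        rw [this, diagonal_one, Matrix.mul_one, h1]
  refine ⟨?_, Matrix.inv_eq_right_inv e2⟩
  have := congrArg det e2
  rw [det_mul, det_one] at this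
  exact IsUnit.of_mul_eq_one _ this

/-- quadratic form -/
def qf {n : Type*} [Fintype n] (A : Matrix n n ℂ) (v : n → ℂ) : ℂ := star v ⬝ᵥ (A *ᵥ v)

theorem qf_diag {n : Type*} [Fintype n] [DecidableEq n] (U : Matrix n n ℂ) (d : n → ℂ) (v : n → ℂ) :
    qf (U * diagonal d * Uᴴ) v = ∑ a, ((‖(Uᴴ *ᵥ v) a‖ ^ 2 : ℝ) : ℂ) * d a := by
  unfold qf
  rw [← mulVec_mulVec, ← mulVec_mulVec, dotProduct_mulVec]
  have : star v ᵥ* U = star (Uᴴ *ᵥ v) := by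
    rw [star_mulVec, conjTranspose_conjTranspose]
  rw [this]
  simp only [dotProduct, mulVec_diagonal, Pi.star_apply]
  refine Finset.sum_congr rfl fun a _ => ?_
  have : star ((Uᴴ *ᵥ v) a) * (Uᴴ *ᵥ v) a = ((‖(Uᴴ *ᵥ v) a‖ ^ 2 : ℝ) : ℂ) := by
    rw [Complex.star_def, Complex.conj_mul']; push_cast; rfl
  rw [← this]; ring

theorem inv_im (l : ℝ) (z : ℂ) : (((l : ℂ) - z)⁻¹).im = z.im / ‖(l : ℂ) - z‖ ^ 2 := by
  rw [Complex.inv_im, Complex.normSq_eq_norm_sq]; simp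

theorem trace_Rz {n : Type*} [Fintype n] [DecidableEq n] {A : Matrix n n ℂ} (hA : A.IsHermitian)
    {z : ℂ} (hz : 0 < z.im) : trace (Rz A z) = ∑ a, ((hA.eigenvalues a : ℂ) - z)⁻¹ := by
  obtain ⟨U, h1, h2, h3, -⟩ := Rz_spec hA
  rw [(h3 z hz).2, Matrix.trace_mul_comm, ← Matrix.mul_assoc, h2, Matrix.one_mul, trace_diagonal]

theorem hs_Rz {n : Type*} [Fintype n] [DecidableEq n] {A : Matrix n n ℂ} (hA : A.IsHermitian)
    {z : ℂ} (hz : 0 < z.im) : ∑ i, ∑ j, ‖Rz A z i j‖ ^ 2 = (trace (Rz A z)).im / z.im := by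
  have key : ((∑ i, ∑ j, ‖Rz A z i j‖ ^ 2 : ℝ) : ℂ) = trace ((Rz A z)ᴴ * Rz A z) := by
    rw [Finset.sum_comm]
    simp only [trace, diag_apply, Matrix.mul_apply, conjTranspose_apply]
    push_cast
    refine Finset.sum_congr rfl fun i _ => Finset.sum_congr rfl fun j _ => ?_
    rw [Complex.star_def, Complex.conj_mul']
  have k2 : trace ((Rz A z)ᴴ * Rz A z) = ((∑ a, 1 / ‖(hA.eigenvalues a : ℂ) - z‖ ^ 2 : ℝ) : ℂ) := by
    obtain ⟨U, h1, h2, h3, -⟩ := Rz_spec hA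
    rw [(h3 z hz).2]
    simp only [conjTranspose_mul, conjTranspose_conjTranspose, diagonal_conjTranspose]
    rw [show ∀ (D E : Matrix n n ℂ), U * (D * Uᴴ) * (U * E * Uᴴ) = U * (D * (Uᴴ * U) * E * Uᴴ) by
      intro D E; simp only [Matrix.mul_assoc]]
    rw [h2, Matrix.mul_one, diagonal_mul_diagonal, Matrix.trace_mul_comm, Matrix.mul_assoc, h2, Matrix.mul_one,
      trace_diagonal]
    push_cast
    refine Finset.sum_congr rfl fun a _ => ?_
    rw [Pi.star_apply, Complex.star_def, Complex.conj_mul']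
    simp
  rw [k2] at key
  have := Complex.ofReal_injective key
  rw [this, trace_Rz hA hz, Complex.im_sum, Finset.sum_div]
  refine Finset.sum_congr rfl fun a _ => ?_
  rw [inv_im]; field_simp

/-- Spectral form of the quadratic form of the resolvent. -/
theorem qf_Rz {n : Type*} [Fintype n] [DecidableEq n] {A : Matrix n n ℂ} (hA : A.IsHermitian)
    (v : n → ℂ) : ∃ c : n → ℝ, (∀ a, 0 ≤ c a) ∧ (∀ z : ℂ, 0 < z.im →
      qf (Rz A z) v = ∑ a, (c a : ℂ) * ((hA.eigenvalues a : ℂ) - z)⁻¹ ∧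
      qf (Rz A z * Rz A z) v = ∑ a, (c a : ℂ) * (((hA.eigenvalues a : ℂ) - z)⁻¹) ^ 2) := by
  obtain ⟨U, h1, h2, h3, -⟩ := Rz_spec hA
  refine ⟨fun a => ‖(Uᴴ *ᵥ v) a‖ ^ 2, fun a => by positivity, fun z hz => ⟨?_, ?_⟩⟩
  · rw [(h3 z hz).2, qf_diag]
  · rw [(h3 z hz).2]
    rw [show ∀ (D E : Matrix n n ℂ), (U * D * Uᴴ) * (U * E * Uᴴ) = U * (D * (Uᴴ * U) * E) * Uᴴ by
      intro D E; simp only [Matrix.mul_assoc]]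
    rw [h2, Matrix.mul_one, diagonal_mul_diagonal, qf_diag]
    simp only [pow_two]

theorem qf_sq_le {n : Type*} [Fintype n] [DecidableEq n] {A : Matrix n n ℂ} (hA : A.IsHermitian)
    (v : n → ℂ) {z : ℂ} (hz : 0 < z.im) :
    ‖qf (Rz A z * Rz A z) v‖ ≤ (qf (Rz A z) v).im / z.im := by
  obtain ⟨c, hc, h⟩ := qf_Rz hA v
  rw [(h z hz).1, (h z hz).2, Complex.im_sum, Finset.sum_div]
  refine (norm_sum_le _ _).trans (Finset.sum_le_sum fun a _ => ?_)
  rw [norm_mul, norm_pow, norm_inv, Complex.norm_real, Real.norm_of_nonneg (hc a), Complex.im_ofReal_mul, inv_im]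
  apply le_of_eq
  field_simp

theorem inv_im_mono (l x η η' : ℝ) (h : 0 < η) (h' : η ≤ η') :
    (((l : ℂ) - (x + η' * Complex.I))⁻¹).im / η' ≤ (((l : ℂ) - (x + η * Complex.I))⁻¹).im / η ∧
    η * (((l : ℂ) - (x + η * Complex.I))⁻¹).im ≤ η' * (((l : ℂ) - (x + η' * Complex.I))⁻¹).im := by
  have e : ∀ t : ℝ, ‖(l : ℂ) - (x + t * Complex.I)‖ ^ 2 = (l - x) ^ 2 + t ^ 2 := by
    intro t
    rw [← Complex.normSq_eq_norm_sq, Complex.normSq_apply]; simp; ring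
  rw [inv_im, inv_im, e, e]
  simp only [Complex.add_im, Complex.ofReal_im, Complex.mul_im, Complex.ofReal_re, Complex.I_im, Complex.I_re]
  have hp : 0 < η' := h.trans_le h'
  have : η ^ 2 ≤ η' ^ 2 := by gcongr
  constructor
  · simp only [mul_one, mul_zero, add_zero, zero_add]
    rw [div_right_comm, div_self hp.ne', div_right_comm, div_self h.ne']
    gcongr
  · simp only [mul_one, mul_zero, add_zero, zero_add]
    rw [← mul_div_assoc, ← mul_div_assoc, div_le_div_iff₀ (by positivity) (by positivity)]
    nlinarith [sq_nonneg (l - x)]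

end WG
end

noncomputable section
open Matrix Finset

namespace WG

/-- column `i` without the diagonal entry -/
def colv {n : ℕ} (H : Matrix (Fin (n+1)) (Fin (n+1)) ℂ) (i : Fin (n+1)) : Fin n → ℂ :=
  fun k => H (i.succAbove k) i

def minr {n : ℕ} (H : Matrix (Fin (n+1)) (Fin (n+1)) ℂ) (i : Fin (n+1)) : Matrix (Fin n) (Fin n) ℂ :=
  H.submatrix i.succAbove i.succAbove

theorem minr_herm {n : ℕ} {H : Matrix (Fin (n+1)) (Fin (n+1)) ℂ} (hH : H.IsHermitian) (i : Fin (n+1)) :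
    (minr H i).IsHermitian := hH.submatrix _

theorem schur {n : ℕ} {H : Matrix (Fin (n+1)) (Fin (n+1)) ℂ} (hH : H.IsHermitian) (i : Fin (n+1))
    {z : ℂ} (hz : 0 < z.im) :
    Rz H z i i * (H i i - z - qf (Rz (minr H i) z) (colv H i)) = 1 ∧
    trace (Rz H z) = trace (Rz (minr H i) z) +
      Rz H z i i * (1 + qf (Rz (minr H i) z * Rz (minr H i) z) (colv H i)) := by
  obtain ⟨_, _, _, hG, _⟩ := Rz_spec hH
  obtain ⟨_, _, _, hR, _⟩ := Rz_spec (minr_herm hH i)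
  have hG1 := Matrix.mul_nonsing_inv _ (hG z hz).1
  have hG2 := Matrix.nonsing_inv_mul _ (hG z hz).1
  have hR1 := Matrix.mul_nonsing_inv _ (hR z hz).1
  have hR2 := Matrix.nonsing_inv_mul _ (hR z hz).1
  change (H - z • 1) * Rz H z = 1 at hG1
  change Rz H z * (H - z • 1) = 1 at hG2
  change (minr H i - z • 1) * Rz (minr H i) z = 1 at hR1
  change Rz (minr H i) z * (minr H i - z • 1) = 1 at hR2
  set G := Rz H z
  set R := Rz (minr H i) z
  set a := colv H i with ha
  set M := minr H i - z • (1 : Matrix (Fin n) (Fin n) ℂ) with hM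
  have hcol : ∀ k, H (i.succAbove k) i = a k := fun k => rfl
  have hrow : ∀ k, H i (i.succAbove k) = star (a k) := fun k => by
    rw [← hcol, hH.apply]
  have hMe : ∀ k l, (H - z • (1 : Matrix (Fin (n+1)) (Fin (n+1)) ℂ)) (i.succAbove k) (i.succAbove l) = M k l := by
    intro k l
    simp [hM, minr, Matrix.one_apply]
  have hne : ∀ k, (H - z • (1 : Matrix (Fin (n+1)) (Fin (n+1)) ℂ)) (i.succAbove k) i = a k := by
    intro k; simp [hcol, Matrix.one_apply, Fin.succAbove_ne]
  have hne' : ∀ k, (H - z • (1 : Matrix (Fin (n+1)) (Fin (n+1)) ℂ)) i (i.succAbove k) = star (a k) := by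
    intro k; simp [hrow, Matrix.one_apply, (Fin.succAbove_ne i k).symm]
  have hii : (H - z • (1 : Matrix (Fin (n+1)) (Fin (n+1)) ℂ)) i i = H i i - z := by simp
  -- column vector of G
  set g : Fin n → ℂ := fun k => G (i.succAbove k) i with hg
  set g' : Fin n → ℂ := fun k => G i (i.succAbove k) with hg'
  have c1 : ∀ k, a k * G i i + (M *ᵥ g) k = 0 := by
    intro k
    have := congrFun (congrFun hG1 (i.succAbove k)) i
    rw [Matrix.mul_apply, Fin.sum_univ_succAbove _ i, hne] at this
    simp only [hMe, Matrix.one_apply, Fin.succAbove_ne, if_false] at this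
    exact this
  have c2 : (H i i - z) * G i i + star a ⬝ᵥ g = 1 := by
    have := congrFun (congrFun hG1 i) i
    rw [Matrix.mul_apply, Fin.sum_univ_succAbove _ i, hii] at this
    simp only [hne', Matrix.one_apply, if_true] at this
    exact this
  have c3 : g = - (G i i) • (R *ᵥ a) := by
    have : M *ᵥ g = - (G i i) • a := by
      funext k
      have := c1 k
      simp only [Pi.smul_apply, smul_eq_mul]
      linear_combination this
    have h2 := congrArg (fun v => R *ᵥ v) this
    simp only [mulVec_mulVec, hR2, one_mulVec, mulVec_smul] at h2
    exact h2
  have c1' : ∀ k, G i i * star (a k) + (g' ᵥ* M) k = 0 := by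
    intro k
    have := congrFun (congrFun hG2 i) (i.succAbove k)
    rw [Matrix.mul_apply, Fin.sum_univ_succAbove _ i, hne'] at this
    simp only [hMe, Matrix.one_apply, (Fin.succAbove_ne i k).symm, if_false] at this
    exact this
  have c3' : g' = - (G i i) • (star a ᵥ* R) := by
    have : g' ᵥ* M = - (G i i) • star a := by
      funext k
      have := c1' k
      simp only [Pi.smul_apply, smul_eq_mul, Pi.star_apply]
      linear_combination this
    have h2 := congrArg (fun v => v ᵥ* R) this
    simp only [vecMul_vecMul, hR1, vecMul_one, smul_vecMul] at h2
    exact h2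
  have hB : ∀ k l, G (i.succAbove k) (i.succAbove l) = R k l - (R *ᵥ a) k * g' l := by
    have : M * (G.submatrix i.succAbove i.succAbove) = 1 - vecMulVec a g' := by
      ext k l
      have := congrFun (congrFun hG1 (i.succAbove k)) (i.succAbove l)
      rw [Matrix.mul_apply, Fin.sum_univ_succAbove _ i, hne] at this
      simp only [hMe, Matrix.one_apply, Fin.succAbove_right_inj] at this
      rw [Matrix.mul_apply, Matrix.sub_apply, Matrix.one_apply, vecMulVec_apply]
      simp only [submatrix_apply]
      linear_combination this
    have h2 := congrArg (fun X => R * X) this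
    simp only [← Matrix.mul_assoc, hR2, Matrix.one_mul, Matrix.mul_sub, Matrix.mul_one] at h2
    intro k l
    have h3 := congrFun (congrFun h2 k) l
    rw [submatrix_apply] at h3
    rw [h3, Matrix.sub_apply, mul_vecMulVec, vecMulVec_apply]
  constructor
  · rw [c3] at c2
    rw [dotProduct_smul, smul_eq_mul] at c2
    unfold qf
    linear_combination c2
  · have t1 : trace G = G i i + ∑ k, (R k k - (R *ᵥ a) k * g' k) := by
      rw [trace, Fin.sum_univ_succAbove _ i]
      simp only [diag_apply, hB]
    rw [t1, Finset.sum_sub_distrib]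
    have t2 : ∑ k, (R *ᵥ a) k * g' k = - G i i * qf (R * R) a := by
      rw [c3']
      unfold qf
      rw [← mulVec_mulVec, dotProduct_mulVec]
      simp only [dotProduct, Pi.smul_apply, smul_eq_mul, Finset.mul_sum]
      refine Finset.sum_congr rfl fun k _ => ?_
      ring
    rw [t2]
    simp only [trace, diag_apply]
    ring

def zz (x : ℝ) (k : ℕ) : ℂ := (x : ℂ) + (((1/2:ℝ) ^ k : ℝ) : ℂ) * Complex.I

theorem zz_im (x : ℝ) (k : ℕ) : (zz x k).im = (1/2:ℝ) ^ k := by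
  simp only [zz, Complex.add_im, Complex.ofReal_im, Complex.im_ofReal_mul, Complex.I_im]; ring
theorem zz_im_pos (x : ℝ) (k : ℕ) : 0 < (zz x k).im := by rw [zz_im]; positivity
theorem zz_re (x : ℝ) (k : ℕ) : (zz x k).re = x := by
  simp only [zz, Complex.add_re, Complex.ofReal_re, Complex.re_ofReal_mul, Complex.I_re]; ring

/-- normalized trace -/
def mk {n : ℕ} (H : Matrix (Fin (n+1)) (Fin (n+1)) ℂ) (x : ℝ) (k : ℕ) : ℂ :=
  trace (Rz H (zz x k)) / ((n : ℂ) + 1)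

def dk {n : ℕ} (H : Matrix (Fin (n+1)) (Fin (n+1)) ℂ) (x : ℝ) (i : Fin (n+1)) (k : ℕ) : ℂ :=
  zz x k + qf (Rz (minr H i) (zz x k)) (colv H i) - H i i

theorem sum_mono {n : Type*} [Fintype n] (c : n → ℝ) (hc : ∀ a, 0 ≤ c a) (l : n → ℝ) (x η η' : ℝ)
    (h : 0 < η) (h' : η ≤ η') :
    (∑ a, (c a : ℂ) * ((l a : ℂ) - (x + η' * Complex.I))⁻¹).im / η' ≤
      (∑ a, (c a : ℂ) * ((l a : ℂ) - (x + η * Complex.I))⁻¹).im / η ∧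
    η * (∑ a, (c a : ℂ) * ((l a : ℂ) - (x + η * Complex.I))⁻¹).im ≤
      η' * (∑ a, (c a : ℂ) * ((l a : ℂ) - (x + η' * Complex.I))⁻¹).im := by
  simp only [Complex.im_sum, Finset.sum_div, Finset.mul_sum, Complex.im_ofReal_mul]
  constructor
  · refine Finset.sum_le_sum fun a _ => ?_
    rw [mul_div_assoc, mul_div_assoc]
    exact mul_le_mul_of_nonneg_left (inv_im_mono (l a) x η η' h h').1 (hc a)
  · refine Finset.sum_le_sum fun a _ => ?_
    have := mul_le_mul_of_nonneg_left (inv_im_mono (l a) x η η' h h').2 (hc a)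
    linarith

theorem mk_eq {n : ℕ} {H : Matrix (Fin (n+1)) (Fin (n+1)) ℂ} (hH : H.IsHermitian) (x : ℝ) (k : ℕ) :
    mk H x k = ∑ a, (((n + 1 : ℝ)⁻¹ : ℝ) : ℂ) * ((hH.eigenvalues a : ℂ) - zz x k)⁻¹ := by
  rw [mk, trace_Rz hH (zz_im_pos x k), ← Finset.mul_sum]; push_cast; rw [div_eq_inv_mul]

theorem mk_step {n : ℕ} {H : Matrix (Fin (n+1)) (Fin (n+1)) ℂ} (hH : H.IsHermitian) (x : ℝ) (k : ℕ) :
    (mk H x k).im / 2 ≤ (mk H x (k+1)).im ∧ (mk H x (k+1)).im ≤ 2 * (mk H x k).im := by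
  have hp : (0:ℝ) < (1/2:ℝ)^k := by positivity
  have := sum_mono (fun _ => (n + 1 : ℝ)⁻¹) (fun _ => by positivity) hH.eigenvalues x ((1/2)^(k+1)) ((1/2)^k)
    (by positivity) (by rw [pow_succ]; linarith)
  rw [mk_eq hH, mk_eq hH]
  change _ / _ ≤ (∑ a, _ * ((hH.eigenvalues a : ℂ) - (x + (((1/2:ℝ) ^ (k+1) : ℝ) : ℂ) * Complex.I))⁻¹).im ∧
    (∑ a, _ * ((hH.eigenvalues a : ℂ) - (x + (((1/2:ℝ) ^ (k+1) : ℝ) : ℂ) * Complex.I))⁻¹).im ≤ _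
  unfold zz
  obtain ⟨h1, h2⟩ := this
  rw [div_le_div_iff₀ hp (by positivity), pow_succ] at h1
  rw [pow_succ] at h2 
  rw [pow_succ]
  constructor
  · refine le_of_mul_le_mul_right ?_ hp
    linarith
  · refine le_of_mul_le_mul_left ?_ hp
    linarith

theorem inv_norm_le (l : ℝ) {z : ℂ} (hz : 0 < z.im) : ‖((l : ℂ) - z)⁻¹‖ ≤ 1 / z.im := by
  rw [norm_inv, one_div]
  refine inv_anti₀ hz ?_
  have := Complex.abs_im_le_norm ((l : ℂ) - z)
  simp at this
  rw [abs_of_pos hz] at this; exact this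

theorem mk_im_nonneg {n : ℕ} {H : Matrix (Fin (n+1)) (Fin (n+1)) ℂ} (hH : H.IsHermitian) (x : ℝ) (k : ℕ) :
    0 ≤ (mk H x k).im := by
  rw [mk_eq hH, Complex.im_sum]
  refine Finset.sum_nonneg fun a _ => ?_
  rw [Complex.im_ofReal_mul, inv_im]
  have := zz_im_pos x k
  positivity

theorem mk_zero {n : ℕ} {H : Matrix (Fin (n+1)) (Fin (n+1)) ℂ} (hH : H.IsHermitian) (x : ℝ) :
    (mk H x 0).im ≤ 1 := by
  refine (Complex.im_le_norm _).trans ?_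
  rw [mk_eq hH]
  refine (norm_sum_le _ _).trans ?_
  calc _ ≤ ∑ a : Fin (n+1), (n + 1 : ℝ)⁻¹ * 1 := by
        refine Finset.sum_le_sum fun a _ => ?_
        rw [norm_mul, Complex.norm_real, Real.norm_of_nonneg (by positivity)]
        gcongr
        have := inv_norm_le (hH.eigenvalues a) (zz_im_pos x 0)
        rwa [zz_im, pow_zero, div_one] at this
    _ ≤ 1 := by
        simp only [Finset.sum_const, Finset.card_univ, Fintype.card_fin, nsmul_eq_mul]
        push_cast
        rw [mul_one, mul_inv_cancel₀ (by positivity)]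

theorem gd {n : ℕ} {H : Matrix (Fin (n+1)) (Fin (n+1)) ℂ} (hH : H.IsHermitian) (x : ℝ) (i : Fin (n+1)) (k : ℕ) :
    Rz H (zz x k) i i * dk H x i k = -1 := by
  have := (schur hH i (zz_im_pos x k)).1
  unfold dk
  linear_combination -this

theorem dk_im {n : ℕ} {H : Matrix (Fin (n+1)) (Fin (n+1)) ℂ} (hH : H.IsHermitian) (x : ℝ) (i : Fin (n+1)) (k : ℕ) :
    (dk H x i k).im = (1/2)^k + (qf (Rz (minr H i) (zz x k)) (colv H i)).im := by
  have h0 : (H i i).im = 0 := by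
    have := hH.apply i i
    exact Complex.conj_eq_iff_im.1 this
  simp [dk, zz_im, h0]

theorem dk_step {n : ℕ} {H : Matrix (Fin (n+1)) (Fin (n+1)) ℂ} (hH : H.IsHermitian) (x : ℝ) (i : Fin (n+1)) (k : ℕ) :
    (1/2:ℝ)^k ≤ (dk H x i k).im ∧ (dk H x i k).im / 2 ≤ (dk H x i (k+1)).im := by
  obtain ⟨c, hc, h⟩ := qf_Rz (minr_herm hH i) (colv H i)
  have hp : (0:ℝ) < (1/2:ℝ)^k := by positivity
  rw [dk_im hH, dk_im hH, (h _ (zz_im_pos x k)).1, (h _ (zz_im_pos x (k+1))).1]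
  constructor
  · have : 0 ≤ (∑ a, (c a : ℂ) * (((minr_herm hH i).eigenvalues a : ℂ) - zz x k)⁻¹).im := by
      rw [Complex.im_sum]
      refine Finset.sum_nonneg fun a _ => ?_
      rw [Complex.im_ofReal_mul, inv_im]
      have := zz_im_pos x k
      have := hc a
      positivity
    linarith
  · have := (sum_mono c hc (minr_herm hH i).eigenvalues x ((1/2)^(k+1)) ((1/2)^k)
      (by positivity) (by rw [pow_succ]; linarith)).1
    change _ ≤ _ + (∑ a, _ * (((minr_herm hH i).eigenvalues a : ℂ) - (x + (((1/2:ℝ) ^ (k+1) : ℝ) : ℂ) * Complex.I))⁻¹).im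
    unfold zz
    rw [div_le_div_iff₀ hp (by positivity), pow_succ] at this
    rw [pow_succ]
    refine le_of_mul_le_mul_right ?_ hp
    nlinarith

theorem trace_diff {n : ℕ} {H : Matrix (Fin (n+1)) (Fin (n+1)) ℂ} (hH : H.IsHermitian) (x : ℝ) (i : Fin (n+1)) (k : ℕ) :
    ‖trace (Rz (minr H i) (zz x k)) - trace (Rz H (zz x k))‖ ≤ 2^k := by
  have hz := zz_im_pos x k
  rw [(schur hH i hz).2, sub_add_cancel_left, norm_neg, norm_mul]
  have h1 : ‖1 + qf (Rz (minr H i) (zz x k) * Rz (minr H i) (zz x k)) (colv H i)‖ ≤ (dk H x i k).im * 2^k := by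
    refine (norm_add_le _ _).trans ?_
    have := qf_sq_le (minr_herm hH i) (colv H i) hz
    rw [dk_im hH, add_mul, ← mul_pow]
    rw [zz_im] at this
    have e : ∀ t : ℝ, t / (1/2)^k = t * 2^k := by
      intro t; rw [one_div, inv_pow, div_inv_eq_mul]
    rw [e] at this
    norm_num
    linarith
  have h2 : ‖Rz H (zz x k) i i‖ * (dk H x i k).im ≤ 1 := by
    have := congrArg norm (gd hH x i k)
    rw [norm_mul, norm_neg, norm_one] at this
    rw [← this]
    gcongr
    exact Complex.im_le_norm _
  calc _ ≤ ‖Rz H (zz x k) i i‖ * ((dk H x i k).im * 2^k) := by gcongr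
    _ = (‖Rz H (zz x k) i i‖ * (dk H x i k).im) * 2^k := by ring
    _ ≤ 1 * 2^k := by gcongr
    _ = _ := one_mul _

end WG
end

noncomputable section
open Matrix Finset

namespace WG

def Sr (b : ℕ → ℝ) : ℕ → ℝ
  | 0 => b 0
  | k+1 => 2 * Sr b k + b (k+1)

theorem Sr_nonneg {b : ℕ → ℝ} (hb : ∀ k, 0 ≤ b k) (k : ℕ) : 0 ≤ Sr b k := by
  induction k with
  | zero => exact hb 0
  | succ k ih => have := hb (k+1); simp only [Sr]; linarith

theorem Sr_ge {b : ℕ → ℝ} (hb : ∀ k, 0 ≤ b k) (k : ℕ) : b k ≤ Sr b k := by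
  cases k with
  | zero => exact le_rfl
  | succ k => have := Sr_nonneg hb k; simp only [Sr]; linarith

theorem Sr_mono {b : ℕ → ℝ} (hb : ∀ k, 0 ≤ b k) : Monotone (Sr b) := by
  refine monotone_nat_of_le_succ fun k => ?_
  have := Sr_nonneg hb k
  have := hb (k+1); simp only [Sr]; linarith

theorem Sr_eq (b : ℕ → ℝ) (J : ℕ) : Sr b J = ∑ k ∈ range (J+1), 2^(J-k) * b k := by
  induction J with
  | zero => simp [Sr]
  | succ J ih =>
    rw [Finset.sum_range_succ]
    simp only [Sr, ih, Finset.mul_sum]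
    congr 1
    · refine Finset.sum_congr rfl fun k hk => ?_
      have : J + 1 - k = (J - k) + 1 := by have := Finset.mem_range.1 hk; omega
      rw [this, pow_succ]; ring
    · simp

theorem core (q0 c1 C2 δ r ε : ℝ) (hq : 0 < q0) (hq1 : q0 ≤ 1) (hc1 : c1 = q0 / 8) (hC2 : C2 = 2 / c1 + 1)
    (hδ : δ = q0 / (2 * (C2 + 3))) (hr : r = δ * c1 ^ 2 / 16) (hε : ε = δ * c1 / 20)
    (n : ℕ) (x η : ℝ) (hx : q0 ≤ 1 - x^2/4) (hη : 0 < η) (hη1 : η ≤ 1)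
    (m z : ℂ) (hzr : z.re = x) (hzi : z.im = η) (g d : Fin (n+1) → ℂ) (b S : Fin (n+1) → ℝ)
    (hgd : ∀ i, g i * d i = -1) (hm : m = (∑ i, g i) / ((n : ℂ)+1)) (hm0 : 0 ≤ m.im)
    (hS : ∀ i, b i ≤ S i) (hS0 : ∀ i, 0 ≤ S i) (hT : ∑ i, S i ≤ ε * (n+1))
    (hgood : ∀ i, b i < 1 → ‖d i - (m + z)‖ ≤ r)
    (hdp : ∀ i, 0 < (d i).im)
    (hw : c1 / 2 ≤ (m + z).im) (hbad : ∀ i, 1 ≤ b i → 1 / (d i).im ≤ 4 / c1 * (1 + S i)) :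
    (c1 ≤ m.im ∧ ‖m‖ ≤ C2) ∧ ∀ i, 1 / (d i).im ≤ 4 / c1 * (1 + S i) := by
  have hc1p : 0 < c1 := by rw [hc1]; linarith
  have hc1l : c1 ≤ 1/8 := by rw [hc1]; linarith
  have hC2p : 1 < C2 := by rw [hC2]; have : 0 < 2 / c1 := by positivity
                           linarith
  have hδp : 0 < δ := by rw [hδ]; positivity
  have hδ1 : δ ≤ 1 := by
    rw [hδ, div_le_one (by positivity)]; linarith
  have hrp : 0 < r := by rw [hr]; positivity
  have hrc : r ≤ c1 / 4 := by rw [hr]; nlinarith [mul_pos hc1p hδp, mul_nonneg hc1p.le (sub_nonneg.2 hδ1)]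
  set w := m + z with hwdef
  have hwn : c1 / 2 ≤ ‖w‖ := hw.trans (Complex.im_le_norm _)
  have hwp : 0 < ‖w‖ := by linarith
  have hw0 : w ≠ 0 := norm_pos_iff.1 hwp
  have hd0 : ∀ i, d i ≠ 0 := fun i h => by have := hdp i; rw [h] at this; simp at this
  have hgi : ∀ i, g i = - (d i)⁻¹ := fun i => by
    have := hgd i
    field_simp [hd0 i]; linear_combination this
  have hdgood : ∀ i, b i < 1 → c1 / 4 ≤ (d i).im := by
    intro i hi
    have h1 := hgood i hi
    have h2 := (Complex.abs_im_le_norm (d i - w)).trans h1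
    rw [Complex.sub_im] at h2
    have := (abs_le.1 h2).1
    linarith
  have hbd : ∀ i, 1 / (d i).im ≤ 4 / c1 * (1 + S i) := by
    intro i
    by_cases hi : b i < 1
    · have h1 := hdgood i hi
      calc 1 / (d i).im ≤ 1 / (c1/4) := one_div_le_one_div_of_le (by positivity) h1
        _ = 4 / c1 * 1 := by field_simp
        _ ≤ _ := by
          have := hS0 i
          gcongr; linarith
    · exact hbad i (not_lt.1 hi)
  refine ⟨?_, hbd⟩
  have hterm : ∀ i, ‖g i + w⁻¹‖ ≤ δ/2 + 10 / c1 * S i := by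
    intro i
    by_cases hi : b i < 1
    · have e : g i + w⁻¹ = (d i - w) * (d i)⁻¹ * w⁻¹ := by
        rw [hgi]; field_simp [hd0 i, hw0]; ring
      rw [e, norm_mul, norm_mul, norm_inv, norm_inv]
      have h1 : ‖d i‖⁻¹ ≤ (c1/4)⁻¹ := inv_anti₀ (by positivity) ((hdgood i hi).trans (Complex.im_le_norm _))
      have h2 : ‖w‖⁻¹ ≤ (c1/2)⁻¹ := inv_anti₀ (by positivity) hwn
      have h3 : 0 ≤ 10 / c1 * S i := mul_nonneg (by positivity) (hS0 i)
      calc _ ≤ r * (c1/4)⁻¹ * (c1/2)⁻¹ := by gcongr; exact hgood i hi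
        _ = δ/2 := by rw [hr]; field_simp; norm_num
        _ ≤ _ := by linarith
    · have hi' := not_lt.1 hi
      have hS1 : 1 ≤ S i := hi'.trans (hS i)
      have h1 : ‖g i‖ ≤ 1 / (d i).im := by
        rw [hgi, norm_neg, norm_inv, one_div]
        exact inv_anti₀ (hdp i) (Complex.im_le_norm _)
      have h2 : ‖w⁻¹‖ ≤ (c1/2)⁻¹ := by rw [norm_inv]; exact inv_anti₀ (by positivity) hwn
      have h3 := hbd i
      calc ‖g i + w⁻¹‖ ≤ ‖g i‖ + ‖w⁻¹‖ := norm_add_le _ _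
        _ ≤ 4/c1 * (1 + S i) + (c1/2)⁻¹ := by linarith
        _ = (6 + 4 * S i) / c1 := by field_simp; ring
        _ ≤ (10 * S i) / c1 := by gcongr; linarith
        _ ≤ _ := by rw [div_mul_eq_mul_div]; linarith
  have hNp : (0:ℝ) < n + 1 := by positivity
  have he : ‖m + w⁻¹‖ ≤ δ := by
    have e : m + w⁻¹ = (∑ i, (g i + w⁻¹)) / ((n:ℂ)+1) := by
      rw [Finset.sum_add_distrib, add_div, ← hm]
      simp only [Finset.sum_const, Finset.card_univ, Fintype.card_fin, nsmul_eq_mul]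
      push_cast
      rw [mul_div_cancel_left₀]
      exact_mod_cast hNp.ne'
    have nn : ‖((n:ℂ)+1)‖ = (n:ℝ)+1 := by
      have : ((n:ℂ)+1) = (((n:ℝ)+1 : ℝ) : ℂ) := by push_cast; rfl
      rw [this, Complex.norm_real, Real.norm_of_nonneg hNp.le]
    rw [e, norm_div, nn, div_le_iff₀ hNp]
    calc ‖∑ i, (g i + w⁻¹)‖ ≤ ∑ i, (δ/2 + 10/c1 * S i) := (norm_sum_le _ _).trans (Finset.sum_le_sum fun i _ => hterm i)
      _ = (n+1) * (δ/2) + 10/c1 * ∑ i, S i := by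
        rw [Finset.sum_add_distrib, ← Finset.mul_sum]
        simp [Finset.card_univ]
      _ ≤ (n+1) * (δ/2) + 10/c1 * (ε * (n+1)) := by gcongr
      _ = δ * (n+1) := by rw [hε]; field_simp; ring
  have hmC : ‖m‖ ≤ C2 := by
    have h2 : ‖w⁻¹‖ ≤ (c1/2)⁻¹ := by rw [norm_inv]; exact inv_anti₀ (by positivity) hwn
    calc ‖m‖ = ‖(m + w⁻¹) - w⁻¹‖ := by rw [add_sub_cancel_right]
      _ ≤ ‖m + w⁻¹‖ + ‖w⁻¹‖ := norm_sub_le _ _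
      _ ≤ 1 + (c1/2)⁻¹ := by linarith
      _ = C2 := by rw [hC2]; field_simp; ring
  refine ⟨?_, hmC⟩
  have hx2 : |x| ≤ 2 := by
    rw [abs_le]; constructor <;> nlinarith
  have hzn : ‖z‖ ≤ 3 := by
    have := Complex.norm_le_abs_re_add_abs_im z
    rw [hzr, hzi, abs_of_pos hη] at this; linarith
  have hwC : ‖w‖ ≤ C2 + 3 := (norm_add_le _ _).trans (by linarith)
  have hq2 : ‖m * w + 1‖ ≤ q0/2 := by
    have : m * w + 1 = (m + w⁻¹) * w := by field_simp
    rw [this, norm_mul]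
    calc _ ≤ δ * (C2 + 3) := by gcongr
      _ = q0/2 := by rw [hδ]; field_simp
  have hre := (Complex.re_le_norm _).trans hq2
  have hre' : (m * w + 1).re = m.re^2 - m.im^2 + x * m.re - η * m.im + 1 := by
    rw [hwdef]; simp [hzr, hzi]; ring
  rw [hre'] at hre
  by_contra hlt
  push Not at hlt
  rw [hc1] at hlt
  nlinarith [sq_nonneg (m.re + x/2), mul_nonneg hm0 (sub_nonneg.2 hη1), mul_nonneg hm0 (sub_nonneg.2 hlt.le)]

theorem boot (q0 : ℝ) (hq : 0 < q0) (hq1 : q0 ≤ 1) :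
    ∃ c1 C2 r ε : ℝ, 0 < c1 ∧ 1 ≤ C2 ∧ 0 < r ∧ 0 < ε ∧
    ∀ (n J : ℕ) (x : ℝ) (_ : q0 ≤ 1 - x^2/4) (H : Matrix (Fin (n+1)) (Fin (n+1)) ℂ) (_ : H.IsHermitian)
     (b : Fin (n+1) → ℕ → ℝ) (_ : ∀ i k, 0 ≤ b i k)
     (_ : ∀ i, ∀ k ≤ J, b i k < 1 → (mk H x k).im ≤ 2 * C2 → ‖dk H x i k - (mk H x k + zz x k)‖ ≤ r)
     (_ : ∑ i, Sr (b i) J ≤ ε * (n+1)),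
     ∀ k ≤ J, c1 ≤ (mk H x k).im ∧ ‖mk H x k‖ ≤ C2 := by
  obtain ⟨c1, hc1⟩ : ∃ c1, c1 = q0/8 := ⟨_, rfl⟩
  obtain ⟨C2, hC2⟩ : ∃ C2, C2 = 2 / c1 + 1 := ⟨_, rfl⟩
  obtain ⟨δ, hδ⟩ : ∃ δ, δ = q0 / (2 * (C2 + 3)) := ⟨_, rfl⟩
  obtain ⟨r, hr⟩ : ∃ r, r = δ * c1 ^ 2 / 16 := ⟨_, rfl⟩
  obtain ⟨ε, hε⟩ : ∃ ε, ε = δ * c1 / 20 := ⟨_, rfl⟩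
  have hc1p : 0 < c1 := by rw [hc1]; linarith
  have hc1l : c1 ≤ 1/8 := by rw [hc1]; linarith
  have hC2p : 1 < C2 := by rw [hC2]; have : 0 < 2 / c1 := by positivity
                           linarith
  have hδp : 0 < δ := by rw [hδ]; positivity
  refine ⟨c1, C2, r, ε, hc1p, hC2p.le, by rw [hr]; positivity, by rw [hε]; positivity, ?_⟩
  intro n J x hx H hH b hb0 hb hT
  have hTk : ∀ k ≤ J, ∑ i, Sr (b i) k ≤ ε * (n+1) := fun k hk =>
    (Finset.sum_le_sum fun i _ => Sr_mono (hb0 i) hk).trans hT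
  have app : ∀ k ≤ J, (mk H x k).im ≤ 2 * C2 → c1/2 ≤ (mk H x k + zz x k).im →
      (∀ i, 1 ≤ b i k → 1 / (dk H x i k).im ≤ 4 / c1 * (1 + Sr (b i) k)) →
      (c1 ≤ (mk H x k).im ∧ ‖mk H x k‖ ≤ C2) ∧ ∀ i, 1 / (dk H x i k).im ≤ 4 / c1 * (1 + Sr (b i) k) := by
    intro k hk h1 h2 h3
    refine core q0 c1 C2 δ r ε hq hq1 hc1 hC2 hδ hr hε n x ((1/2)^k) hx (by positivity)
      (pow_le_one₀ (by norm_num) (by norm_num)) (mk H x k) (zz x k) (zz_re x k) (zz_im x k)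
      (fun i => Rz H (zz x k) i i) (fun i => dk H x i k) (fun i => b i k) (fun i => Sr (b i) k)
      (fun i => gd hH x i k) rfl (mk_im_nonneg hH x k) (fun i => Sr_ge (hb0 i) k) (fun i => Sr_nonneg (hb0 i) k)
      (hTk k hk) (fun i hi => hb i k hk hi h1) (fun i => ?_) h2 h3
    exact lt_of_lt_of_le (by positivity) (dk_step hH x i k).1
  have main : ∀ k ≤ J, (c1 ≤ (mk H x k).im ∧ ‖mk H x k‖ ≤ C2) ∧
      ∀ i, 1 / (dk H x i k).im ≤ 4 / c1 * (1 + Sr (b i) k) := by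
    intro k
    induction k with
    | zero =>
      intro hk
      refine app 0 hk ?_ ?_ ?_
      · have := mk_zero hH x; linarith
      · rw [Complex.add_im, zz_im, pow_zero]
        have := mk_im_nonneg hH x 0; linarith
      · intro i hi
        have h1 := (dk_step hH x i 0).1
        rw [pow_zero] at h1
        have h2 : 1 / (dk H x i 0).im ≤ 1 := by
          rw [div_le_one (by linarith)]; exact h1
        have h3 := Sr_nonneg (hb0 i) 0
        have h4 : 1 ≤ 4 / c1 := by rw [le_div_iff₀ hc1p]; linarith
        nlinarith
    | succ k ih =>
      intro hk
      obtain ⟨⟨i1, i2⟩, i3⟩ := ih (by omega)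
      have st := mk_step hH x k
      refine app (k+1) hk ?_ ?_ ?_
      · have := (Complex.im_le_norm (mk H x k)).trans i2
        linarith
      · rw [Complex.add_im, zz_im]
        have : (0:ℝ) < (1/2)^(k+1) := by positivity
        linarith
      · intro i hi
        have h1 := dk_step hH x i k
        have hp : 0 < (dk H x i k).im := lt_of_lt_of_le (by positivity) h1.1
        have h2 : 1 / (dk H x i (k+1)).im ≤ 1 / ((dk H x i k).im / 2) :=
          one_div_le_one_div_of_le (by positivity) h1.2
        have h3 : 1 / ((dk H x i k).im / 2) = 2 * (1 / (dk H x i k).im) := by field_simp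
        have h4 := i3 i
        have : 0 < 4 / c1 := by positivity
        simp only [Sr]
        calc _ ≤ 2 * (4 / c1 * (1 + Sr (b i) k)) := by rw [h3] at h2; linarith
          _ = 4 / c1 * (1 + (2 * Sr (b i) k + 1)) := by ring
          _ ≤ _ := by gcongr
  exact fun k hk => (main k hk).1

end WG
end

noncomputable section
open MeasureTheory ProbabilityTheory
open scoped ENNReal

namespace WG

/-- exponential as an extended nonnegative real -/
def ee (t : ℝ) : ℝ≥0∞ := ENNReal.ofReal (Real.exp t)

theorem ee_add (s t : ℝ) : ee (s + t) = ee s * ee t := by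
  unfold ee; rw [Real.exp_add, ENNReal.ofReal_mul (Real.exp_pos _).le]

theorem ee_mono {s t : ℝ} (h : s ≤ t) : ee s ≤ ee t :=
  ENNReal.ofReal_le_ofReal (Real.exp_le_exp.2 h)

theorem ee_sum {ι : Type*} (s : Finset ι) (f : ι → ℝ) : ee (∑ i ∈ s, f i) = ∏ i ∈ s, ee (f i) := by
  unfold ee; rw [Real.exp_sum, ENNReal.ofReal_prod_of_nonneg fun i _ => (Real.exp_pos _).le]

theorem ee_meas : Measurable ee := by unfold ee; fun_prop

@[fun_prop]
theorem ee_meas' {α : Type*} [MeasurableSpace α] {f : α → ℝ} (hf : Measurable f) :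
    Measurable fun a => ee (f a) := ee_meas.comp hf

/-- AM-GM -/
theorem ee_amgm (s t : ℝ) : ee (s + t) ≤ ee (2 * s) + ee (2 * t) := by
  unfold ee
  rw [← ENNReal.ofReal_add (Real.exp_pos _).le (Real.exp_pos _).le]
  refine ENNReal.ofReal_le_ofReal ?_
  have : Real.exp (2 * s) + Real.exp (2 * t) ≥ 2 * Real.exp (s + t) := by
    rw [two_mul, two_mul, Real.exp_add, Real.exp_add, Real.exp_add]
    nlinarith [sq_nonneg (Real.exp s - Real.exp t)]
  have := Real.exp_pos (s + t)
  linarith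

/-- subgaussian law on `ℂ` -/
structure SubG (δ D : ℝ) (μ : Measure ℂ) : Prop where
  prob : IsProbabilityMeasure μ
  mean : ∫ z, z ∂μ = 0
  mom : ∫⁻ z, ee (δ * ‖z‖ ^ 2) ∂μ ≤ ENNReal.ofReal D

theorem exp_le_id_add (y : ℝ) : Real.exp y ≤ y + Real.exp (y ^ 2) := by
  rcases le_total |y| 1 with h | h
  · have h1 := Real.abs_exp_sub_one_sub_id_le h
    have h2 := (abs_le.1 h1).2
    have h3 := Real.add_one_le_exp (y ^ 2)
    linarith
  · rcases le_abs'.1 h with h | h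
    · have h1 : Real.exp y ≤ 1 := Real.exp_le_one_iff.2 (by linarith)
      have h3 := Real.add_one_le_exp (y ^ 2)
      nlinarith
    · have : Real.exp y ≤ Real.exp (y ^ 2) := Real.exp_le_exp.2 (by nlinarith)
      linarith

theorem exp_le_quad (y : ℝ) : Real.exp y ≤ 1 + y + y ^ 2 * Real.exp |y| := by
  rcases le_total |y| 1 with h | h
  · have h1 := Real.abs_exp_sub_one_sub_id_le h
    have h2 := (abs_le.1 h1).2
    have h3 : 1 ≤ Real.exp |y| := Real.one_le_exp (abs_nonneg _)
    nlinarith [sq_nonneg y]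
  · have h3 : 1 ≤ Real.exp |y| := Real.one_le_exp (abs_nonneg _)
    rcases le_abs'.1 h with h | h
    · have h1 : Real.exp y ≤ 1 := Real.exp_le_one_iff.2 (by linarith)
      nlinarith
    · have : Real.exp y ≤ Real.exp |y| := Real.exp_le_exp.2 (le_abs_self _)
      have h5 : Real.exp |y| ≤ y ^ 2 * Real.exp |y| :=
        le_mul_of_one_le_left (Real.exp_pos _).le (by nlinarith)
      linarith

section scalar
variable {δ D : ℝ} {μ : Measure ℂ}

theorem SubG.int_exp (h : SubG δ D μ) : Integrable (fun z : ℂ => Real.exp (δ * ‖z‖ ^ 2)) μ := by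
  refine ⟨by fun_prop, ?_⟩
  rw [hasFiniteIntegral_iff_ofReal (Filter.Eventually.of_forall fun _ => (Real.exp_pos _).le)]
  exact h.mom.trans_lt ENNReal.ofReal_lt_top

theorem SubG.int_exp_le (h : SubG δ D μ) (hD : 0 ≤ D) : ∫ z, Real.exp (δ * ‖z‖ ^ 2) ∂μ ≤ D := by
  rw [integral_eq_lintegral_of_nonneg_ae (Filter.Eventually.of_forall fun _ => (Real.exp_pos _).le) (by fun_prop)]
  exact ENNReal.toReal_le_of_le_ofReal hD h.mom

theorem SubG.int_sq (h : SubG δ D μ) (hδ : 0 < δ) : Integrable (fun z : ℂ => ‖z‖ ^ 2) μ := by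
  refine (h.int_exp.const_mul (1/δ)).mono' (by fun_prop) (Filter.Eventually.of_forall fun z => ?_)
  rw [Real.norm_of_nonneg (by positivity)]
  have := Real.add_one_le_exp (δ * ‖z‖^2)
  rw [one_div, ← div_eq_inv_mul, le_div_iff₀ hδ]
  linarith

theorem SubG.int_id (h : SubG δ D μ) (hδ : 0 < δ) : Integrable (fun z : ℂ => z) μ := by
  have := h.prob
  refine ((h.int_sq hδ).add (integrable_const 1)).mono' (by fun_prop) (Filter.Eventually.of_forall fun z => ?_)
  simp only [Pi.add_apply]
  nlinarith [sq_nonneg (‖z‖ - 1), norm_nonneg z]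

theorem SubG.mgf (h : SubG δ D μ) (hδ : 0 < δ) (hD : 1 ≤ D) (c : ℂ) :
    ∫⁻ z, ee (c * z).re ∂μ ≤ ee (D / δ * ‖c‖ ^ 2) := by
  have := h.prob
  have hre : ∀ z : ℂ, |(c * z).re| ≤ ‖c‖ * ‖z‖ := fun z => by
    rw [← norm_mul]; exact Complex.abs_re_le_norm _
  rcases le_total (‖c‖^2) δ with hc | hc
  · set t := ‖c‖^2 / δ with ht
    have ht0 : 0 ≤ t := by positivity
    have ht1 : t ≤ 1 := by rw [ht, div_le_one hδ]; exact hc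
    have hpt : ∀ z : ℂ, Real.exp (c * z).re ≤ (c * z).re + (1 + t * (Real.exp (δ * ‖z‖^2) - 1)) := by
      intro z
      refine (exp_le_id_add _).trans ?_
      gcongr
      have h1 : (c * z).re ^ 2 ≤ t * (δ * ‖z‖^2) := by
        have : t * (δ * ‖z‖^2) = (‖c‖ * ‖z‖)^2 := by rw [ht]; field_simp
        rw [this, ← sq_abs]
        have := hre z
        gcongr
      refine (Real.exp_le_exp.2 h1).trans ?_
      have := convexOn_exp.2 (Set.mem_univ (0:ℝ)) (Set.mem_univ (δ * ‖z‖^2)) (sub_nonneg.2 ht1) ht0 (by ring)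
      simp only [smul_eq_mul, mul_zero, zero_add, Real.exp_zero, mul_one] at this
      linarith
    have i1 : Integrable (fun z : ℂ => (c * z).re) μ := ((h.int_id hδ).const_mul c).re
    have i4 : Integrable (fun z : ℂ => t * (Real.exp (δ * ‖z‖^2) - 1)) μ :=
      ((h.int_exp.sub (integrable_const 1)).const_mul t)
    have i2 : Integrable (fun z : ℂ => 1 + t * (Real.exp (δ * ‖z‖^2) - 1)) μ :=
      (integrable_const 1).add i4
    have i3 : Integrable (fun z : ℂ => Real.exp (c * z).re) μ := by
      refine (i1.add i2).mono' (by fun_prop) (Filter.Eventually.of_forall fun z => ?_)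
      rw [Real.norm_of_nonneg (Real.exp_pos _).le]
      exact hpt z
    have e0 : ∫ z, (c * z).re ∂μ = 0 := by
      have h1 := integral_re ((h.int_id hδ).const_mul c)
      have h2 : ∫ z, c * z ∂μ = 0 := by rw [integral_const_mul, h.mean, mul_zero]
      rw [h2] at h1
      simpa using h1
    have e1 : ∫ z, Real.exp (c * z).re ∂μ ≤ Real.exp (D / δ * ‖c‖^2) := by
      calc _ ≤ ∫ z, ((c * z).re + (1 + t * (Real.exp (δ * ‖z‖^2) - 1))) ∂μ :=
            integral_mono i3 (i1.add i2) hpt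
        _ = 1 + t * (∫ z, Real.exp (δ * ‖z‖^2) ∂μ - 1) := by
            rw [integral_add i1 i2, e0, integral_add (integrable_const 1) i4,
              integral_const_mul, integral_sub h.int_exp (integrable_const 1)]
            simp
        _ ≤ 1 + t * D := by
            have := h.int_exp_le (by linarith)
            gcongr; linarith
        _ = D / δ * ‖c‖^2 + 1 := by rw [ht]; ring
        _ ≤ _ := Real.add_one_le_exp _
    unfold ee
    rw [← ofReal_integral_eq_lintegral_ofReal i3 (Filter.Eventually.of_forall fun _ => (Real.exp_pos _).le)]
    exact ENNReal.ofReal_le_ofReal e1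
  · have hpt : ∀ z : ℂ, ee (c * z).re ≤ ee (‖c‖^2/δ) * ee (δ * ‖z‖^2) := by
      intro z
      rw [← ee_add]
      refine ee_mono ((le_abs_self _).trans ((hre z).trans ?_))
      rw [div_add' _ _ _ hδ.ne', le_div_iff₀ hδ]
      nlinarith [sq_nonneg (‖c‖ - δ * ‖z‖), sq_nonneg (‖c‖), sq_nonneg (δ * ‖z‖)]
    calc _ ≤ ∫⁻ z, ee (‖c‖^2/δ) * ee (δ * ‖z‖^2) ∂μ := lintegral_mono hpt
      _ = ee (‖c‖^2/δ) * ∫⁻ z, ee (δ * ‖z‖^2) ∂μ := by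
        rw [lintegral_const_mul _ (by fun_prop)]
      _ ≤ ee (‖c‖^2/δ) * ENNReal.ofReal D := by gcongr; exact h.mom
      _ ≤ ee (‖c‖^2/δ) * ee (D - 1) := by
        gcongr
        refine ENNReal.ofReal_le_ofReal ?_
        have := Real.add_one_le_exp (D - 1); linarith
      _ = ee (‖c‖^2/δ + (D-1)) := by rw [ee_add]
      _ ≤ _ := by
        refine ee_mono ?_
        have : 1 ≤ ‖c‖^2/δ := by rw [le_div_iff₀ hδ]; linarith
        have e : D / δ * ‖c‖^2 = D * (‖c‖^2/δ) := by ring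
        rw [e]; nlinarith

theorem SubG.mgf_sq (h : SubG δ D μ) (hδ : 0 < δ) (hD : 1 ≤ D) (hv : ∫ z, ‖z‖^2 ∂μ = 1) (α : ℝ) (hα : |α| ≤ δ/4) :
    ∫⁻ z, ee (α * (‖z‖^2 - 1)) ∂μ ≤ ee (32 / δ^2 * Real.exp (δ/2) * D * α^2) := by
  have := h.prob
  set s := δ/4 with hs
  have hsp : 0 < s := by positivity
  set K := 2 * (α/s)^2 * Real.exp (δ/2) with hK
  have hpt : ∀ z : ℂ, Real.exp (α * (‖z‖^2 - 1)) ≤ 1 + α * (‖z‖^2 - 1) + K * Real.exp (δ * ‖z‖^2) := by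
    intro z
    refine (exp_le_quad _).trans ?_
    set Y := ‖z‖^2 - 1
    have hY : |Y| ≤ ‖z‖^2 + 1 := by
      rw [abs_le]; constructor <;> simp only [Y] <;> nlinarith [sq_nonneg ‖z‖]
    have h1 : |α * Y| ≤ s * |Y| := by rw [abs_mul]; gcongr
    have h2 : (α * Y)^2 = (α/s)^2 * (s * |Y|)^2 := by
      rw [mul_pow s, sq_abs]; field_simp
    have h3 : (s * |Y|)^2 ≤ 2 * Real.exp (s * |Y|) := by
      have := Real.quadratic_le_exp_of_nonneg (x := s * |Y|) (by positivity)
      have : 0 ≤ s * |Y| := by positivity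
      nlinarith
    have key : (α * Y)^2 * Real.exp |α * Y| ≤ K * Real.exp (δ * ‖z‖^2) := by
     calc
      (α * Y)^2 * Real.exp |α * Y| ≤ ((α/s)^2 * (2 * Real.exp (s * |Y|))) * Real.exp (s * |Y|) := by
          rw [h2]
          exact mul_le_mul (mul_le_mul_of_nonneg_left h3 (sq_nonneg _)) (Real.exp_le_exp.2 h1) (Real.exp_pos _).le (by positivity)
      _ = 2 * (α/s)^2 * Real.exp (2 * (s * |Y|)) := by rw [two_mul (s * |Y|), Real.exp_add]; ring
      _ ≤ 2 * (α/s)^2 * Real.exp (δ/2 + δ * ‖z‖^2) := by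
          gcongr
          rw [hs]; nlinarith [sq_nonneg ‖z‖, mul_nonneg hδ.le (sq_nonneg ‖z‖)]
      _ = _ := by rw [Real.exp_add, hK]; ring
    linarith
  have i4 : Integrable (fun z : ℂ => α * (‖z‖^2 - 1)) μ :=
    ((h.int_sq hδ).sub (integrable_const 1)).const_mul α
  have i1 : Integrable (fun z : ℂ => 1 + α * (‖z‖^2 - 1)) μ :=
    (integrable_const 1).add i4
  have i2 : Integrable (fun z : ℂ => K * Real.exp (δ * ‖z‖^2)) μ := h.int_exp.const_mul K
  have i3 : Integrable (fun z : ℂ => Real.exp (α * (‖z‖^2 - 1))) μ := by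
    refine (i1.add i2).mono' (by fun_prop) (Filter.Eventually.of_forall fun z => ?_)
    rw [Real.norm_of_nonneg (Real.exp_pos _).le]
    exact hpt z
  unfold ee
  rw [← ofReal_integral_eq_lintegral_ofReal i3 (Filter.Eventually.of_forall fun _ => (Real.exp_pos _).le)]
  refine ENNReal.ofReal_le_ofReal ?_
  calc _ ≤ ∫ z, (1 + α * (‖z‖^2 - 1) + K * Real.exp (δ * ‖z‖^2)) ∂μ := integral_mono i3 (i1.add i2) hpt
    _ = 1 + K * ∫ z, Real.exp (δ * ‖z‖^2) ∂μ := by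
      rw [integral_add i1 i2, integral_add (integrable_const 1) i4,
        integral_const_mul, integral_const_mul, integral_sub (h.int_sq hδ) (integrable_const 1), hv]
      simp
    _ ≤ 1 + K * D := by
      have := h.int_exp_le (by linarith)
      gcongr
    _ = 32 / δ^2 * Real.exp (δ/2) * D * α^2 + 1 := by rw [hK, hs]; field_simp; ring
    _ ≤ _ := Real.add_one_le_exp _

end scalar
end WG
end

noncomputable section
open MeasureTheory ProbabilityTheory
open scoped ENNReal

namespace WG

/-- product of functions of coordinates -/
theorem lint_pi {ι : Type*} [Fintype ι] (μ : ι → Measure ℂ) [∀ i, IsProbabilityMeasure (μ i)]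
    (f : ι → ℂ → ℝ≥0∞) (hf : ∀ i, Measurable (f i)) :
    ∫⁻ z, ∏ i, f i (z i) ∂(Measure.pi μ) = ∏ i, ∫⁻ x, f i x ∂(μ i) := by
  have h1 := iIndepFun_pi (μ := μ) (X := f) (fun i => (hf i).aemeasurable)
  rw [lintegral_prod_eq_prod_lintegral_of_indepFun Finset.univ (fun i (z : ι → ℂ) => f i (z i)) h1
    (fun i => (hf i).comp (measurable_pi_apply i))]
  refine Finset.prod_congr rfl fun i _ => ?_
  exact (measurePreserving_eval μ i).lintegral_comp (hf i)

theorem ee_zero : ee 0 = 1 := by simp [ee]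

section
variable {δ D : ℝ}

theorem lin_mgf (hδ : 0 < δ) (hD : 1 ≤ D) {ι : Type*} [Fintype ι] (μ : ι → Measure ℂ)
    (h : ∀ i, SubG δ D (μ i)) (c : ι → ℂ) :
    ∫⁻ z, ee (∑ j, c j * z j).re ∂(Measure.pi μ) ≤ ee (D / δ * ∑ j, ‖c j‖ ^ 2) := by
  have : ∀ i, IsProbabilityMeasure (μ i) := fun i => (h i).prob
  simp_rw [Complex.re_sum, ee_sum]
  rw [lint_pi μ (fun j x => ee (c j * x).re) (fun j => by fun_prop), Finset.mul_sum, ee_sum]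
  exact Finset.prod_le_prod' fun i _ => (h i).mgf hδ hD _

theorem diag_mgf (hδ : 0 < δ) (hD : 1 ≤ D) {ι : Type*} [Fintype ι] (μ : ι → Measure ℂ)
    (h : ∀ i, SubG δ D (μ i)) (hv : ∀ i, ∫ z, ‖z‖ ^ 2 ∂(μ i) = 1) (a : ι → ℝ) (ha : ∀ i, |a i| ≤ δ / 4) :
    ∫⁻ z, ee (∑ j, a j * (‖z j‖ ^ 2 - 1)) ∂(Measure.pi μ) ≤
      ee (32 / δ^2 * Real.exp (δ/2) * D * ∑ j, a j ^ 2) := by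
  have : ∀ i, IsProbabilityMeasure (μ i) := fun i => (h i).prob
  simp_rw [ee_sum]
  rw [lint_pi μ (fun j x => ee (a j * (‖x‖ ^ 2 - 1))) (fun j => by fun_prop), Finset.mul_sum, ee_sum]
  exact Finset.prod_le_prod' fun i _ => (h i).mgf_sq hδ hD (hv i) _ (ha i)

/-- the Gaussian constant -/
def Cg : ℝ≥0∞ := ∫⁻ g, ee (g ^ 2 / 4) ∂(gaussianReal 0 1)

theorem Cg_lt : Cg < ⊤ := by
  unfold Cg
  rw [gaussianReal_of_var_ne_zero 0 one_ne_zero,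
    lintegral_withDensity_eq_lintegral_mul _ (measurable_gaussianPDF 0 1) (by fun_prop)]
  have hi := (integrable_exp_neg_mul_sq (b := 1/4) (by norm_num)).const_mul ((Real.sqrt (2 * Real.pi))⁻¹)
  refine lt_of_le_of_lt (lintegral_mono fun x => ?_) hi.lintegral_lt_top
  simp only [Pi.mul_apply, gaussianPDF, gaussianPDFReal, ee]
  rw [← ENNReal.ofReal_mul (by positivity)]
  refine ENNReal.ofReal_le_ofReal (le_of_eq ?_)
  simp only [NNReal.coe_one, mul_one, sub_zero]
  rw [mul_assoc, ← Real.exp_add]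
  congr 2; ring

theorem gauss_mix (s : ℝ) : ∫⁻ g, ee (s * g) ∂(gaussianReal 0 1) = ee (s ^ 2 / 2) := by
  unfold ee
  rw [← ofReal_integral_eq_lintegral_ofReal (integrable_exp_mul_gaussianReal s)
    (Filter.Eventually.of_forall fun _ => (Real.exp_pos _).le)]
  have := mgf_gaussianReal (p := gaussianReal 0 1) (X := id) (μ := 0) (v := 1) (by simp) s
  unfold mgf at this
  simp only [id] at this
  rw [this]; simp

theorem sq_re (hδ : 0 < δ) (hD : 1 ≤ D) {ι : Type*} [Fintype ι] (μ : ι → Measure ℂ)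
    (h : ∀ i, SubG δ D (μ i)) (c : ι → ℂ) (τ : ℝ) (hτ : 0 ≤ τ) (hc : 8 * (D / δ) * τ * ∑ j, ‖c j‖ ^ 2 ≤ 1) :
    ∫⁻ z, ee (τ * (∑ j, c j * z j).re ^ 2) ∂(Measure.pi μ) ≤ Cg := by
  have : ∀ i, IsProbabilityMeasure (μ i) := fun i => (h i).prob
  have e1 : ∀ z : ι → ℂ, ee (τ * (∑ j, c j * z j).re ^ 2) =
      ∫⁻ g, ee (Real.sqrt (2 * τ) * (∑ j, c j * z j).re * g) ∂(gaussianReal 0 1) := by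
    intro z
    rw [gauss_mix, mul_pow, Real.sq_sqrt (by positivity)]
    congr 1; ring
  simp_rw [e1]
  rw [lintegral_lintegral_swap (by
    unfold Function.uncurry
    apply Measurable.aemeasurable
    fun_prop)]
  unfold Cg
  refine lintegral_mono fun g => ?_
  have e2 : ∀ z : ι → ℂ, Real.sqrt (2 * τ) * (∑ j, c j * z j).re * g =
      (∑ j, (((Real.sqrt (2 * τ) * g : ℝ) : ℂ) * c j) * z j).re := by
    intro z
    simp_rw [mul_assoc]
    rw [← Finset.mul_sum, Complex.re_ofReal_mul]
    ring
  simp_rw [e2]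
  refine (lin_mgf hδ hD μ h _).trans (ee_mono ?_)
  simp_rw [norm_mul, mul_pow, ← Finset.mul_sum]
  rw [Complex.norm_real, Real.norm_eq_abs, sq_abs, mul_pow, Real.sq_sqrt (by positivity)]
  nlinarith [sq_nonneg g, mul_le_mul_of_nonneg_right hc (sq_nonneg g)]

theorem sq_norm (hδ : 0 < δ) (hD : 1 ≤ D) {ι : Type*} [Fintype ι] (μ : ι → Measure ℂ)
    (h : ∀ i, SubG δ D (μ i)) (c : ι → ℂ) (τ : ℝ) (hτ : 0 ≤ τ) (hc : 16 * (D / δ) * τ * ∑ j, ‖c j‖ ^ 2 ≤ 1) :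
    ∫⁻ z, ee (τ * ‖∑ j, c j * z j‖ ^ 2) ∂(Measure.pi μ) ≤ Cg + Cg := by
  have h1 := sq_re hδ hD μ h c (2 * τ) (by positivity) (by linarith)
  have h2 := sq_re hδ hD μ h (fun j => -Complex.I * c j) (2 * τ) (by positivity) (by simp; linarith)
  refine le_trans ?_ (add_le_add h1 h2)
  rw [← lintegral_add_left (by fun_prop)]
  refine lintegral_mono fun z => ?_
  have e : (∑ j, (-Complex.I * c j) * z j).re = (∑ j, c j * z j).im := by
    simp_rw [mul_assoc]
    rw [← Finset.mul_sum]; simp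
  simp only [e]
  rw [mul_assoc, mul_assoc]
  refine le_trans (le_of_eq ?_) (ee_amgm _ _)
  rw [← Complex.normSq_eq_norm_sq, Complex.normSq_apply]
  congr 1; ring

theorem exp_convex {ι : Type*} [Fintype ι] (β x : ι → ℝ) (hβ : ∀ i, 0 ≤ β i) (h1 : ∑ i, β i ≤ 1) :
    Real.exp (∑ i, β i * x i) ≤ 1 + ∑ i, β i * Real.exp (x i) := by
  have := convexOn_exp.map_sum_le (t := Finset.univ)
    (w := fun o : Option ι => o.elim (1 - ∑ i, β i) β) (p := fun o => o.elim 0 x)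
    (by rintro (_ | i) _ <;> simp [h1, hβ]) (by simp [Fintype.sum_option]) (by simp)
  simp only [Fintype.sum_option, Option.elim, smul_eq_mul, mul_zero, zero_add, Real.exp_zero, mul_one] at this
  have : 0 ≤ ∑ i, β i := Finset.sum_nonneg fun i _ => hβ i
  linarith

theorem sq_mat (hδ : 0 < δ) (hD : 1 ≤ D) {ι κ : Type*} [Fintype ι] [Fintype κ] (μ : ι → Measure ℂ)
    (h : ∀ i, SubG δ D (μ i)) (M : κ → ι → ℂ) (τ : ℝ) (hτ : 0 ≤ τ)
    (hc : 16 * (D / δ) * τ * ∑ k, ∑ j, ‖M k j‖ ^ 2 ≤ 1) :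
    ∫⁻ z, ee (τ * ∑ k, ‖∑ j, M k j * z j‖ ^ 2) ∂(Measure.pi μ) ≤ 1 + (Cg + Cg) := by
  have : ∀ i, IsProbabilityMeasure (μ i) := fun i => (h i).prob
  rcases hτ.eq_or_lt with rfl | hτ'
  · simp [ee_zero]
  set V : κ → ℝ := fun k => ∑ j, ‖M k j‖ ^ 2 with hV
  have hV0 : ∀ k, 0 ≤ V k := fun k => by positivity
  set β : κ → ℝ := fun k => 16 * (D / δ) * τ * V k with hβ
  have hβ0 : ∀ k, 0 ≤ β k := fun k => by have := hV0 k; positivity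
  have hβ1 : ∑ k, β k ≤ 1 := by rw [hβ, ← Finset.mul_sum]; exact hc
  have hpt : ∀ z : ι → ℂ, ee (τ * ∑ k, ‖∑ j, M k j * z j‖ ^ 2) ≤
      1 + ∑ k, ENNReal.ofReal (β k) * ee (τ / β k * ‖∑ j, M k j * z j‖ ^ 2) := by
    intro z
    have e1 : τ * ∑ k, ‖∑ j, M k j * z j‖ ^ 2 = ∑ k, β k * (τ / β k * ‖∑ j, M k j * z j‖ ^ 2) := by
      rw [Finset.mul_sum]
      refine Finset.sum_congr rfl fun k _ => ?_
      by_cases hk : V k = 0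
      · have : ∀ j, M k j = 0 := by
          intro j
          have := (Finset.sum_eq_zero_iff_of_nonneg (fun j _ => sq_nonneg ‖M k j‖)).1 hk j (Finset.mem_univ _)
          simpa using this
        simp [this]
      · have : β k ≠ 0 := by
          have : 0 < D / δ := by positivity
          simp only [hβ]; positivity
        field_simp
    rw [e1]
    unfold ee
    refine (ENNReal.ofReal_le_ofReal (exp_convex β _ hβ0 hβ1)).trans ?_
    refine ENNReal.ofReal_add_le.trans ?_
    rw [ENNReal.ofReal_one, ENNReal.ofReal_sum_of_nonneg (fun k _ => mul_nonneg (hβ0 k) (Real.exp_pos _).le)]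
    simp_rw [ENNReal.ofReal_mul (hβ0 _)]
    exact le_rfl
  refine (lintegral_mono hpt).trans ?_
  rw [lintegral_add_left (by fun_prop), lintegral_finsetSum _ (fun k _ => by fun_prop)]
  simp only [lintegral_const, measure_univ, mul_one]
  gcongr
  calc _ ≤ ∑ k, ENNReal.ofReal (β k) * (Cg + Cg) := by
        refine Finset.sum_le_sum fun k _ => ?_
        rw [lintegral_const_mul _ (by fun_prop)]
        gcongr
        refine sq_norm hδ hD μ h (M k) (τ / β k) (div_nonneg hτ (hβ0 k)) ?_
        have : 16 * (D / δ) * (τ / β k) * V k = β k / β k := by rw [hβ]; ring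
        rw [this]; exact div_self_le_one _
    _ = (ENNReal.ofReal (∑ k, β k)) * (Cg + Cg) := by
        rw [ENNReal.ofReal_sum_of_nonneg (fun k _ => hβ0 k), Finset.sum_mul]
    _ ≤ 1 * (Cg + Cg) := by gcongr; exact ENNReal.ofReal_le_one.2 hβ1
    _ = _ := one_mul _

end
end WG
end

noncomputable section
open MeasureTheory ProbabilityTheory
open scoped ENNReal ComplexConjugate

namespace WG
section
variable {δ D : ℝ}

theorem lint_cons {n : ℕ} (μ : Fin (n+1) → Measure ℂ) [∀ i, IsProbabilityMeasure (μ i)]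
    (f : (Fin (n+1) → ℂ) → ℝ≥0∞) (hf : Measurable f) :
    ∫⁻ z, f z ∂(Measure.pi μ) =
      ∫⁻ y, ∫⁻ x, f (Fin.cons x y) ∂(μ 0) ∂(Measure.pi fun j : Fin n => μ j.succ) := by
  have h := (measurePreserving_piFinSuccAbove μ 0).symm
  have hm : Measurable fun a => f ((MeasurableEquiv.piFinSuccAbove (fun _ : Fin (n+1) => ℂ) 0).symm a) :=
    hf.comp (MeasurableEquiv.measurable _)
  rw [← h.lintegral_comp hf, lintegral_prod_symm' _ hm]
  simp only [Fin.zero_succAbove]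
  refine lintegral_congr fun y => lintegral_congr fun x => ?_
  congr 1
  funext i
  simp [MeasurableEquiv.piFinSuccAbove_symm_apply, Fin.insertNthEquiv]

theorem supermart (hδ : 0 < δ) (hD : 1 ≤ D) : ∀ (n : ℕ) (μ : Fin n → Measure ℂ)
    (_ : ∀ i, SubG δ D (μ i)) (M : Fin n → Fin n → ℂ),
    ∫⁻ z, ee (∑ k, ((conj (z k) * ∑ j, (if k < j then M k j else 0) * z j).re
      - D / δ * ‖∑ j, (if k < j then M k j else 0) * z j‖ ^ 2)) ∂(Measure.pi μ) ≤ 1 := by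
  intro n
  induction n with
  | zero =>
    intro μ h M
    have : ∀ i, IsProbabilityMeasure (μ i) := fun i => (h i).prob
    simp [ee_zero]
  | succ n ih =>
    intro μ h M
    have : ∀ i, IsProbabilityMeasure (μ i) := fun i => (h i).prob
    have := ih (fun j => μ j.succ) (fun j => h _) (fun k j => M k.succ j.succ)
    rw [lint_cons μ _ (by
      refine ee_meas' (Finset.measurable_sum _ fun k _ => ?_)
      fun_prop)]
    refine le_trans (lintegral_mono fun y => ?_) this
    simp only [Fin.sum_univ_succ, Fin.cons_zero, Fin.cons_succ, lt_self_iff_false, if_false, zero_mul, zero_add,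
      Fin.succ_pos, if_true, Fin.not_lt_zero, Fin.succ_lt_succ_iff]
    set u := ∑ i : Fin n, M 0 i.succ * y i with hu
    set R := ∑ k : Fin n, ((conj (y k) * ∑ j, (if k < j then M k.succ j.succ else 0) * y j).re
      - D / δ * ‖∑ j, (if k < j then M k.succ j.succ else 0) * y j‖ ^ 2) with hR
    have e : ∀ x : ℂ, ee ((conj x * u).re - D / δ * ‖u‖^2 + R) = ee (conj u * x).re * ee (- (D / δ * ‖u‖^2) + R) := by
      intro x
      rw [← ee_add]
      congr 1
      have : (conj x * u).re = (conj u * x).re := by simp; ring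
      rw [this]; ring
    simp_rw [e]
    rw [lintegral_mul_const _ (by fun_prop)]
    refine (mul_le_mul_left ((h 0).mgf hδ hD _) _).trans ?_
    rw [← ee_add, Complex.norm_conj]
    exact ee_mono (by linarith)

/-- HS norm squared -/
def HS {n : ℕ} (A : Matrix (Fin n) (Fin n) ℂ) : ℝ := ∑ i, ∑ j, ‖A i j‖ ^ 2

theorem sum_offdiag {n : ℕ} (f : Fin n → Fin n → ℝ) :
    ∑ k, ∑ j, f k j = ∑ k, f k k + ∑ k, ∑ j, (if k < j then f k j + f j k else 0) := by
  have h1 : ∀ k j : Fin n, f k j = (if k = j then f k j else 0) + ((if k < j then f k j else 0) + (if j < k then f k j else 0)) := by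
    intro k j
    rcases lt_trichotomy k j with h | h | h
    · simp [h, h.ne, h.le, not_lt.2 h.le]
    · simp [h]
    · simp [h, h.ne', not_lt.2 h.le]
  have h2 : ∑ k, ∑ j, (if j < k then f k j else 0) = ∑ k, ∑ j, (if k < j then f j k else 0) :=
    Finset.sum_comm
  have h3 : ∀ k j : Fin n, (if k < j then f k j + f j k else 0) = (if k < j then f k j else 0) + (if k < j then f j k else 0) := by
    intro k j; split_ifs <;> simp
  calc _ = ∑ k, ∑ j, ((if k = j then f k j else 0) + ((if k < j then f k j else 0) + (if j < k then f k j else 0))) := by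
        exact Finset.sum_congr rfl fun k _ => Finset.sum_congr rfl fun j _ => h1 k j
    _ = _ := by
      simp_rw [h3, Finset.sum_add_distrib, h2]
      simp

/-- constants -/
def th0 (δ D : ℝ) : ℝ := min (δ/8) (1 / (32 * (D/δ)))

theorem hw_re (hδ : 0 < δ) (hD : 1 ≤ D) {n : ℕ} (μ : Fin n → Measure ℂ)
    (h : ∀ i, SubG δ D (μ i)) (hv : ∀ i, ∫ z, ‖z‖ ^ 2 ∂(μ i) = 1) (A : Matrix (Fin n) (Fin n) ℂ) (hA : HS A ≤ 1) :
    ∫⁻ z, ee (th0 δ D * (qf A z - A.trace).re) ∂(Measure.pi μ) ≤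
      ee (32 / δ^2 * Real.exp (δ/2) * D * (δ^2/16)) + (1 + (1 + (Cg + Cg))) := by
  have : ∀ i, IsProbabilityMeasure (μ i) := fun i => (h i).prob
  set θ := th0 δ D with hθ
  have hB : 0 < D / δ := by positivity
  have hθ0 : 0 < θ := by rw [hθ]; unfold th0; positivity
  have hθ1 : θ ≤ δ / 8 := min_le_left _ _
  have hθ2 : θ * (32 * (D/δ)) ≤ 1 := by rw [← le_div_iff₀ (by positivity)]; exact min_le_right _ _
  have hdiag : ∑ i, ‖A i i‖ ^ 2 ≤ 1 := by
    refine le_trans (Finset.sum_le_sum fun i _ => ?_) hA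
    exact Finset.single_le_sum (f := fun j => ‖A i j‖^2) (fun j _ => sq_nonneg _) (Finset.mem_univ i)
  set M : Fin n → Fin n → ℂ := fun k j => (4 * θ : ℝ) * (A k j + conj (A j k)) with hM
  set M' : Fin n → Fin n → ℂ := fun k j => if k < j then M k j else 0 with hM'
  set a : Fin n → ℝ := fun i => 2 * θ * (A i i).re with ha
  have hMM : ∑ k, ∑ j, ‖M' k j‖ ^ 2 ≤ 32 * θ ^ 2 := by
    have h0 : ∀ k j, ‖M' k j‖ ^ 2 ≤ 32 * θ^2 * (if k < j then ‖A k j‖^2 + ‖A j k‖^2 else 0) := by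
      intro k j
      simp only [hM', hM]
      split_ifs
      · rw [norm_mul, mul_pow, Complex.norm_real, Real.norm_eq_abs, sq_abs]
        have h1 : ‖A k j + conj (A j k)‖ ≤ ‖A k j‖ + ‖A j k‖ := (norm_add_le _ _).trans (by rw [Complex.norm_conj])
        have h2 : ‖A k j + conj (A j k)‖^2 ≤ 2 * (‖A k j‖^2 + ‖A j k‖^2) := by
          nlinarith [sq_nonneg (‖A k j‖ - ‖A j k‖), norm_nonneg (A k j + conj (A j k))]
        nlinarith [mul_le_mul_of_nonneg_left h2 (sq_nonneg (4 * θ))]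
      · simp
    calc _ ≤ ∑ k, ∑ j, 32 * θ^2 * (if k < j then ‖A k j‖^2 + ‖A j k‖^2 else 0) :=
          Finset.sum_le_sum fun k _ => Finset.sum_le_sum fun j _ => h0 k j
      _ = 32 * θ^2 * ∑ k, ∑ j, (if k < j then ‖A k j‖^2 + ‖A j k‖^2 else 0) := by
          simp_rw [Finset.mul_sum]
      _ ≤ 32 * θ^2 * 1 := by
          gcongr
          refine le_trans ?_ hA
          unfold HS
          rw [sum_offdiag (fun k j => ‖A k j‖^2)]
          have : 0 ≤ ∑ i, ‖A i i‖ ^ 2 := by positivity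
          linarith
      _ = _ := by ring
  have hX : ∀ z : Fin n → ℂ, θ * (qf A z - A.trace).re = 
      1/2 * ∑ i, a i * (‖z i‖^2 - 1) + (1/4) * ∑ k, (conj (z k) * ∑ j, M' k j * z j).re := by
    intro z
    have e1 : (qf A z).re = ∑ k, ∑ j, (conj (z k) * (A k j * z j)).re := by
      simp only [qf, dotProduct, Matrix.mulVec, Pi.star_apply, Complex.re_sum, Finset.mul_sum]
      rfl
    have e2 : ∀ k, (conj (z k) * (A k k * z k)).re = (A k k).re * ‖z k‖^2 := by
      intro k
      have : conj (z k) * (A k k * z k) = A k k * ((‖z k‖^2 : ℝ):ℂ) := by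
        rw [Complex.ofReal_pow, ← Complex.conj_mul']; ring
      rw [this, Complex.re_mul_ofReal]
    have e3 : ∀ k, (conj (z k) * ∑ j, M' k j * z j).re = 4 * θ * 
        ∑ j, (if k < j then (conj (z k) * (A k j * z j)).re + (conj (z j) * (A j k * z k)).re else 0) := by
      intro k
      rw [Finset.mul_sum, Complex.re_sum, Finset.mul_sum]
      refine Finset.sum_congr rfl fun j _ => ?_
      simp only [hM', hM]
      split_ifs
      · simp only [Complex.mul_re, Complex.mul_im, Complex.add_re, Complex.add_im, Complex.conj_re, Complex.conj_im,
          Complex.ofReal_re, Complex.ofReal_im]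
        ring
      · simp
    rw [Complex.sub_re, e1, sum_offdiag (fun k j => (conj (z k) * (A k j * z j)).re), Finset.sum_congr rfl (fun k _ => e3 k),
      Finset.sum_congr rfl (fun k _ => e2 k), ← Finset.mul_sum, Matrix.trace, Complex.re_sum]
    have e4 : ∑ i, a i * (‖z i‖^2 - 1) = 2 * θ * (∑ k, (A k k).re * ‖z k‖^2 - ∑ k, (A k k).re) := by
      rw [← Finset.sum_sub_distrib, Finset.mul_sum]
      exact Finset.sum_congr rfl fun i _ => by simp only [ha]; ring
    rw [e4]
    simp only [Matrix.diag_apply]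
    ring
  set S : (Fin n → ℂ) → ℝ := fun z => ∑ k, ((conj (z k) * ∑ j, M' k j * z j).re - D / δ * ‖∑ j, M' k j * z j‖ ^ 2)
  set Q : (Fin n → ℂ) → ℝ := fun z => ∑ k, ‖∑ j, M' k j * z j‖ ^ 2
  have hpt : ∀ z, ee (θ * (qf A z - A.trace).re) ≤ ee (∑ i, a i * (‖z i‖^2 - 1)) + (ee (S z) + ee (D / δ * Q z)) := by
    intro z
    have hS : ∑ k, (conj (z k) * ∑ j, M' k j * z j).re = S z + D / δ * Q z := by
      simp only [S, Q]
      rw [Finset.sum_sub_distrib, Finset.mul_sum]; ring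
    rw [hX, hS]
    refine (ee_amgm _ _).trans ?_
    refine add_le_add (ee_mono (by linarith)) ?_
    refine le_trans (ee_mono (le_of_eq ?_)) ((ee_amgm (1/2 * S z) (1/2 * (D / δ * Q z))).trans ?_)
    · ring
    · exact add_le_add (ee_mono (by linarith)) (ee_mono (by linarith))
  refine (lintegral_mono hpt).trans ?_
  have mS : Measurable S := by
    refine Finset.measurable_sum _ fun k _ => ?_
    fun_prop
  have mQ : Measurable Q := by
    refine Finset.measurable_sum _ fun k _ => ?_
    fun_prop
  rw [lintegral_add_left (by fun_prop), lintegral_add_left (by fun_prop)]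
  refine add_le_add ?_ (add_le_add ?_ ?_)
  · refine (diag_mgf hδ hD μ h hv a ?_).trans (ee_mono ?_)
    · intro i
      simp only [ha]
      rw [abs_mul, abs_of_pos (by positivity : 0 < 2 * θ)]
      have h1 : |(A i i).re| ≤ 1 := by
        refine (Complex.abs_re_le_norm _).trans ?_
        have : ‖A i i‖^2 ≤ 1 := le_trans (Finset.single_le_sum (f := fun j => ‖A j j‖^2) (fun j _ => sq_nonneg _) (Finset.mem_univ i)) hdiag
        nlinarith [norm_nonneg (A i i)]
      nlinarith [abs_nonneg (A i i).re]
    · gcongr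
      calc ∑ j, a j ^ 2 ≤ ∑ j, (δ/4)^2 * ‖A j j‖^2 := by
            refine Finset.sum_le_sum fun j _ => ?_
            simp only [ha]
            rw [mul_pow, ← sq_abs (A j j).re]
            have := Complex.abs_re_le_norm (A j j)
            have : 2 * θ ≤ δ/4 := by linarith
            gcongr
        _ = (δ/4)^2 * ∑ j, ‖A j j‖^2 := by rw [Finset.mul_sum]
        _ ≤ (δ/4)^2 * 1 := by gcongr
        _ = _ := by ring
  · exact supermart hδ hD n μ h M
  · refine sq_mat hδ hD μ h M' (D/δ) hB.le ?_
    calc _ ≤ 16 * (D / δ) * (D / δ) * (32 * θ^2) := by gcongr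
      _ = 1/2 * (θ * (32 * (D/δ)))^2 := by ring
      _ ≤ 1/2 * 1^2 := by gcongr
      _ ≤ 1 := by norm_num

/-- Hanson-Wright -/
theorem hw (hδ : 0 < δ) (hD : 1 ≤ D) : ∃ θ C : ℝ, 0 < θ ∧ 0 < C ∧ ∀ {n : ℕ} (μ : Fin n → Measure ℂ)
    (_ : ∀ i, SubG δ D (μ i)) (_ : ∀ i, ∫ z, ‖z‖ ^ 2 ∂(μ i) = 1) (A : Matrix (Fin n) (Fin n) ℂ) (s : ℝ) (_ : 0 < s)
    (_ : HS A ≤ s ^ 2),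
    ∫⁻ z, ee (θ / s * ‖qf A z - A.trace‖) ∂(Measure.pi μ) ≤ ENNReal.ofReal C := by
  set C0 : ℝ≥0∞ := ee (32 / δ^2 * Real.exp (δ/2) * D * (δ^2/16)) + (1 + (1 + (Cg + Cg))) with hC0
  have hCt : C0 ≠ ⊤ := by
    have := Cg_lt.ne
    have : ee (32 / δ^2 * Real.exp (δ/2) * D * (δ^2/16)) ≠ ⊤ := ENNReal.ofReal_ne_top
    simp [hC0, *]
  set C1 := C0 + C0 + (C0 + C0) with hC1
  have hC1t : C1 ≠ ⊤ := by simp [hC1, hCt]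
  have hθ0 : 0 < th0 δ D := by unfold th0; positivity
  refine ⟨th0 δ D / 2, C1.toReal, by positivity, ?_, ?_⟩
  · refine ENNReal.toReal_pos ?_ hC1t
    simp [hC1, hC0]
  intro n μ h hv A s hs hA
  rw [ENNReal.ofReal_toReal hC1t]
  have key : ∀ c : ℂ, ‖c‖ = 1 → ∫⁻ z, ee (th0 δ D * (c / s * (qf A z - A.trace)).re) ∂(Measure.pi μ) ≤ C0 := by
    intro c hc
    have := hw_re hδ hD μ h hv ((c / s) • A) (by
      unfold HS at hA ⊢
      simp only [Matrix.smul_apply, smul_eq_mul, norm_mul, mul_pow, ← Finset.mul_sum, norm_div, hc, Complex.norm_real,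
        Real.norm_eq_abs, div_pow, sq_abs, one_pow]
      rw [one_div, ← div_eq_inv_mul, div_le_one (by positivity)]
      exact hA)
    convert this using 6 with z
    simp [qf, Matrix.smul_mulVec, mul_sub]
  have hpt : ∀ z : Fin n → ℂ, ee (th0 δ D / 2 / s * ‖qf A z - A.trace‖) ≤
     (ee (th0 δ D * ((1:ℂ) / s * (qf A z - A.trace)).re) + ee (th0 δ D * ((-1:ℂ) / s * (qf A z - A.trace)).re)) +
     (ee (th0 δ D * ((Complex.I:ℂ) / s * (qf A z - A.trace)).re) + ee (th0 δ D * ((-Complex.I:ℂ) / s * (qf A z - A.trace)).re)) := by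
    intro z
    generalize qf A z - A.trace = w
    have e : ∀ c : ℂ, (c / s * w).re = (c * w).re / s := by
      intro c; rw [div_mul_eq_mul_div, Complex.div_ofReal_re]
    simp only [e]
    simp only [one_mul, neg_mul, Complex.neg_re, Complex.I_mul_re, neg_neg]
    have hn := Complex.norm_le_abs_re_add_abs_im w
    refine (ee_mono (?_ : _ ≤ th0 δ D / 2 * (|w.re| / s) + th0 δ D / 2 * (|w.im| / s))).trans ((ee_amgm _ _).trans ?_)
    · rw [← mul_add, ← add_div, div_mul_eq_mul_div, mul_div_assoc]
      gcongr
    · refine add_le_add ?_ ?_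
      · rcases abs_cases w.re with ⟨h, _⟩ | ⟨h, _⟩
        · rw [h]; refine le_trans (ee_mono (by linarith)) le_self_add
        · rw [h]; refine le_trans (ee_mono (by linarith)) le_add_self
      · rcases abs_cases w.im with ⟨h, _⟩ | ⟨h, _⟩
        · rw [h]; refine le_trans (ee_mono (by linarith)) le_add_self
        · rw [h]; refine le_trans (ee_mono (by linarith)) le_self_add
  have mq : Measurable fun z : Fin n → ℂ => qf A z := by
    unfold qf dotProduct Matrix.mulVec dotProduct
    simp only [Pi.star_apply]
    refine Finset.measurable_sum _ fun k _ => ?_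
    refine Measurable.mul ?_ ?_
    · exact continuous_star.measurable.comp (measurable_pi_apply k)
    · fun_prop
  refine (lintegral_mono hpt).trans ?_
  rw [lintegral_add_left (by fun_prop), lintegral_add_left (by fun_prop), lintegral_add_left (by fun_prop)]
  exact add_le_add (add_le_add (key _ (by simp)) (key _ (by simp))) (add_le_add (key _ (by simp)) (key _ (by simp)))
end
end WG
end

noncomputable section
open MeasureTheory ProbabilityTheory
open scoped ENNReal ComplexConjugate

namespace WG

/-- entrywise measurability -/
def MM {β : Type*} [MeasurableSpace β] {n : ℕ} (R : β → Matrix (Fin n) (Fin n) ℂ) : Prop :=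
  ∀ i j, Measurable fun w => R w i j

theorem MM.det {β : Type*} [MeasurableSpace β] {n : ℕ} {R : β → Matrix (Fin n) (Fin n) ℂ} (h : MM R) :
    Measurable fun w => (R w).det := by
  simp_rw [Matrix.det_apply]
  refine Finset.measurable_sum _ fun σ _ => ?_
  refine Measurable.const_smul (Finset.measurable_prod _ fun i _ => h _ _) _

theorem MM.inv {β : Type*} [MeasurableSpace β] {n : ℕ} {R : β → Matrix (Fin n) (Fin n) ℂ} (h : MM R) :
    MM fun w => (R w)⁻¹ := by
  intro i j
  simp_rw [Matrix.inv_def, Matrix.smul_apply, Ring.inverse_eq_inv', smul_eq_mul, Matrix.adjugate_apply]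
  refine h.det.inv.mul (MM.det fun k l => ?_)
  simp_rw [Matrix.updateRow_apply]
  split_ifs
  · exact measurable_const
  · exact h k l

theorem MM.Rz {β : Type*} [MeasurableSpace β] {n : ℕ} {R : β → Matrix (Fin n) (Fin n) ℂ} (h : MM R) (z : ℂ) :
    MM fun w => Rz (R w) z := by
  refine MM.inv fun i j => ?_
  simp only [Matrix.sub_apply]
  exact (h i j).sub measurable_const

theorem MM.trace {β : Type*} [MeasurableSpace β] {n : ℕ} {R : β → Matrix (Fin n) (Fin n) ℂ} (h : MM R) :
    Measurable fun w => (R w).trace := Finset.measurable_sum _ fun i _ => h i i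

theorem MM.HS {β : Type*} [MeasurableSpace β] {n : ℕ} {R : β → Matrix (Fin n) (Fin n) ℂ} (h : MM R) :
    Measurable fun w => HS (R w) :=
  Finset.measurable_sum _ fun i _ => Finset.measurable_sum _ fun j _ => (h i j).norm.pow_const 2

theorem MM.qf {β : Type*} [MeasurableSpace β] {n : ℕ} {R : β → Matrix (Fin n) (Fin n) ℂ} (h : MM R)
    {a : β → Fin n → ℂ} (ha : Measurable a) :
    Measurable fun w => qf (R w) (a w) := by
  unfold WG.qf dotProduct Matrix.mulVec dotProduct
  simp only [Pi.star_apply]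
  refine Finset.measurable_sum _ fun k _ => ?_
  refine Measurable.mul ?_ (Finset.measurable_sum _ fun j _ => (h k j).mul ((measurable_pi_apply j).comp ha))
  exact continuous_star.measurable.comp ((measurable_pi_apply k).comp ha)

theorem hw_indep {δ D : ℝ} (hδ : 0 < δ) (hD : 1 ≤ D) : ∃ θ C : ℝ, 0 < θ ∧ 0 < C ∧ 
    ∀ {Ω β : Type} [MeasurableSpace Ω] [MeasurableSpace β] (P : Measure Ω) [IsProbabilityMeasure P] {n : ℕ}
      (μ : Fin n → Measure ℂ)
      (_ : ∀ i, SubG δ D (μ i)) (_ : ∀ i, ∫ z, ‖z‖ ^ 2 ∂(μ i) = 1)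
      (a : Ω → Fin n → ℂ) (W : Ω → β) (_ : Measurable a) (_ : Measurable W) (_ : P.map a = Measure.pi μ)
      (_ : IndepFun a W P) (R : β → Matrix (Fin n) (Fin n) ℂ) (_ : MM R) (s t : ℝ) (_ : 0 < s),
      P {x | HS (R (W x)) ≤ s ^ 2 ∧ t ≤ ‖qf (R (W x)) (a x) - (R (W x)).trace‖} ≤
        ENNReal.ofReal (C * Real.exp (-(θ * t / s))) := by
  obtain ⟨θ, C, hθ, hC, H⟩ := hw hδ hD
  refine ⟨θ, C, hθ, hC, ?_⟩
  intro Ω β _ _ P _ n μ hμ hv a W ma mW hmap hind R mR s t hs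
  have : ∀ i, IsProbabilityMeasure (μ i) := fun i => (hμ i).prob
  have hprod := (indepFun_iff_map_prod_eq_prod_map_map ma.aemeasurable mW.aemeasurable).1 hind
  have : IsProbabilityMeasure (P.map W) := Measure.isProbabilityMeasure_map mW.aemeasurable
  set f : (Fin n → ℂ) × β → ℝ≥0∞ := fun p =>
    Set.indicator {p : (Fin n → ℂ) × β | HS (R p.2) ≤ s ^ 2}
      (fun p => ee (θ / s * ‖qf (R p.2) p.1 - (R p.2).trace‖)) p with hf
  have mR2 : MM fun p : (Fin n → ℂ) × β => R p.2 := fun i j => (mR i j).comp measurable_snd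
  have mf : Measurable f := by
    refine Measurable.indicator ?_ (measurableSet_le mR2.HS measurable_const)
    refine ee_meas' (Measurable.const_mul (Measurable.norm (Measurable.sub (mR2.qf measurable_fst) mR2.trace)) _)
  have h1 : ∫⁻ x, f (a x, W x) ∂P ≤ ENNReal.ofReal C := by
    rw [← lintegral_map (f := f) (g := fun x => (a x, W x)) mf (ma.prodMk mW), hprod, lintegral_prod_symm' _ mf]
    calc _ ≤ ∫⁻ y, ENNReal.ofReal C ∂(P.map W) := by
          refine lintegral_mono fun w => ?_
          simp only [hf, hmap]
          by_cases hw : HS (R w) ≤ s ^ 2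
          · refine le_trans (lintegral_mono fun z => ?_) (H μ hμ hv (R w) s hs hw)
            exact Set.indicator_le_self _ _ _
          · have : ∀ z : Fin n → ℂ, Set.indicator {p : (Fin n → ℂ) × β | HS (R p.2) ≤ s ^ 2}
              (fun p => ee (θ / s * ‖qf (R p.2) p.1 - (R p.2).trace‖)) (z, w) = 0 :=
              fun z => Set.indicator_of_notMem (show (z, w) ∉ {p : (Fin n → ℂ) × β | HS (R p.2) ≤ s ^ 2} from hw) _
            simp [this]
      _ = _ := by simp
  have h2 : ee (θ * t / s) * P {x | HS (R (W x)) ≤ s ^ 2 ∧ t ≤ ‖qf (R (W x)) (a x) - (R (W x)).trace‖} ≤ ENNReal.ofReal C := by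
    refine le_trans ?_ h1
    refine le_trans ?_ (mul_meas_ge_le_lintegral (mf.comp (ma.prodMk mW)) (ee (θ * t / s)))
    refine mul_le_mul_right (measure_mono ?_) _
    rintro x ⟨hx1, hx2⟩
    simp only [hf, Set.mem_ofPred_eq, Function.comp]
    rw [Set.indicator_of_mem (show (a x, W x) ∈ {p : (Fin n → ℂ) × β | HS (R p.2) ≤ s ^ 2} from hx1)]
    refine ee_mono ?_
    rw [mul_div_right_comm]
    gcongr
  rw [Real.exp_neg, ← div_eq_mul_inv, ENNReal.ofReal_div_of_pos (Real.exp_pos _)]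
  rw [ENNReal.le_div_iff_mul_le (Or.inl (by simp [Real.exp_pos])) (Or.inl ENNReal.ofReal_ne_top), mul_comm]
  exact h2

theorem SubG.conj {δ D : ℝ} {μ : Measure ℂ} (h : SubG δ D μ) : SubG δ D (μ.map conj) := by
  have := h.prob
  have mc : Measurable (conj : ℂ → ℂ) := Complex.continuous_conj.measurable
  refine ⟨Measure.isProbabilityMeasure_map mc.aemeasurable, ?_, ?_⟩
  · rw [integral_map mc.aemeasurable (by fun_prop), integral_conj, h.mean, map_zero]
  · rw [lintegral_map (by fun_prop) mc]
    simpa using h.mom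

theorem var_conj {μ : Measure ℂ} (hv : ∫ z, ‖z‖ ^ 2 ∂μ = 1) : ∫ z, ‖z‖ ^ 2 ∂(μ.map conj) = 1 := by
  have mc : Measurable (conj : ℂ → ℂ) := Complex.continuous_conj.measurable
  rw [integral_map mc.aemeasurable (by fun_prop)]
  simpa using hv

theorem SubG.ofR {δ D : ℝ} {μ : Measure ℝ} [IsProbabilityMeasure μ] (h : ∫ x, x ∂μ = 0)
    (hm : ∫⁻ x, ENNReal.ofReal (Real.exp (δ * x ^ 2)) ∂μ ≤ ENNReal.ofReal D) :
    SubG δ D (μ.map (fun x : ℝ => (x : ℂ))) := by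
  have mc : Measurable (fun x : ℝ => (x : ℂ)) := by fun_prop
  refine ⟨Measure.isProbabilityMeasure_map mc.aemeasurable, ?_, ?_⟩
  · rw [integral_map mc.aemeasurable (by fun_prop), show ∫ x : ℝ, (x:ℂ) ∂μ = ((∫ x, x ∂μ : ℝ):ℂ) from integral_ofReal, h]; simp
  · rw [lintegral_map (by fun_prop) mc]
    simpa [ee] using hm

/-- index set of independent entries -/
abbrev Idx (N : ℕ) : Type := {p : Fin N × Fin N // p.1 ≤ p.2}

/-- canonical matrix -/
def Hm {N : ℕ} (x : Idx N → ℂ) : Matrix (Fin N) (Fin N) ℂ := fun i j =>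
  (((Real.sqrt N)⁻¹ : ℝ) : ℂ) * (if h : i < j then x ⟨(i, j), h.le⟩ else
    if h' : j < i then conj (x ⟨(j, i), h'.le⟩) else ((x ⟨(i, i), le_rfl⟩).re : ℂ))

theorem Hm_herm {N : ℕ} (x : Idx N → ℂ) : (Hm x).IsHermitian := by
  ext i j
  rw [Matrix.conjTranspose_apply]
  unfold Hm
  rw [star_mul']
  have : star (((Real.sqrt N)⁻¹ : ℝ) : ℂ) = (((Real.sqrt N)⁻¹ : ℝ) : ℂ) := Complex.conj_ofReal _
  rw [this]
  congr 1
  rcases lt_trichotomy i j with h | h | h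
  · simp [h, not_lt.2 h.le]
  · subst h; simp
  · simp [h, not_lt.2 h.le]

theorem Hm_MM {N : ℕ} : MM (fun x : Idx N → ℂ => Hm x) := by
  intro i j
  unfold Hm
  refine Measurable.const_mul ?_ _
  split_ifs
  · exact measurable_pi_apply _
  · exact Complex.continuous_conj.measurable.comp (measurable_pi_apply _)
  · fun_prop

/-- canonical laws -/
structure Laws (δ D : ℝ) (N : ℕ) (μ : Idx N → Measure ℂ) : Prop where
  sub : ∀ p, SubG δ D (μ p)
  var : ∀ p : Idx N, p.1.1 ≠ p.1.2 → ∫ z, ‖z‖ ^ 2 ∂(μ p) = 1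

/-- sorted pair -/
def sp {N : ℕ} (i j : Fin N) : Idx N := if h : i ≤ j then ⟨(i, j), h⟩ else ⟨(j, i), (not_le.1 h).le⟩

theorem sp_mem {N : ℕ} (i j : Fin N) : (sp i j).1 = (i, j) ∨ (sp i j).1 = (j, i) := by
  unfold sp; split_ifs <;> simp

/-- normalized column -/
def av {n : ℕ} (x : Idx (n+1) → ℂ) (i : Fin (n+1)) : Fin n → ℂ := fun k =>
  (if i.succAbove k < i then (id : ℂ → ℂ) else conj) (x (sp (i.succAbove k) i))

theorem colv_av {n : ℕ} (x : Idx (n+1) → ℂ) (i : Fin (n+1)) (k : Fin n) :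
    colv (Hm x) i k = (((Real.sqrt (n+1 : ℕ))⁻¹ : ℝ) : ℂ) * av x i k := by
  unfold colv Hm av sp
  congr 1
  have hne : i.succAbove k ≠ i := Fin.succAbove_ne i k
  rcases lt_or_gt_of_ne hne with h | h
  · simp [h, h.le]
  · simp [h, not_lt.2 h.le, not_le.2 h]

/-- kill the row `i` -/
def kill {n : ℕ} (i : Fin (n+1)) (x : Idx (n+1) → ℂ) : Idx (n+1) → ℂ := fun p =>
  if p.1.1 = i ∨ p.1.2 = i then 0 else x p

theorem minr_kill {n : ℕ} (i : Fin (n+1)) (x : Idx (n+1) → ℂ) : minr (Hm (kill i x)) i = minr (Hm x) i := by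
  ext k l
  simp only [minr, Matrix.submatrix_apply, Hm, kill]
  simp [Fin.succAbove_ne]

theorem canon_indep {δ D : ℝ} {n : ℕ} {μ : Idx (n+1) → Measure ℂ} (h : Laws δ D (n+1) μ) (i : Fin (n+1)) :
    Measurable (fun x => av x i) ∧ Measurable (kill i) ∧ IndepFun (fun x => av x i) (kill i) (Measure.pi μ) ∧
    ∃ μ' : Fin n → Measure ℂ, (Measure.pi μ).map (fun x => av x i) = Measure.pi μ' ∧
      (∀ k, SubG δ D (μ' k)) ∧ (∀ k, ∫ z, ‖z‖ ^ 2 ∂(μ' k) = 1) := by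
  have hp : ∀ p, IsProbabilityMeasure (μ p) := fun p => (h.sub p).prob
  have mc : Measurable (conj : ℂ → ℂ) := Complex.continuous_conj.measurable
  have mφ : ∀ k : Fin n, Measurable (if i.succAbove k < i then (id : ℂ → ℂ) else conj) := by
    intro k; split_ifs; exacts [measurable_id, mc]
  have mav : Measurable (fun x : Idx (n+1) → ℂ => av x i) :=
    measurable_pi_lambda _ fun k => (mφ k).comp (measurable_pi_apply _)
  have mkill : Measurable (kill (n := n) i) := by
    refine measurable_pi_lambda _ fun p => ?_
    unfold kill
    split_ifs
    · exact measurable_const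
    · exact measurable_pi_apply _
  have hI : iIndepFun (fun (p : Idx (n+1)) (x : Idx (n+1) → ℂ) => x p) (Measure.pi μ) :=
    iIndepFun_pi (X := fun _ => id) (fun _ => aemeasurable_id)
  refine ⟨mav, mkill, ?_, ?_⟩
  · set S : Finset (Idx (n+1)) := Finset.univ.filter fun p => p.1.1 = i ∨ p.1.2 = i with hS
    have h1 := hI.indepFun_finset S Sᶜ disjoint_compl_right (fun p => measurable_pi_apply p)
    have hmem : ∀ k : Fin n, sp (i.succAbove k) i ∈ S := by
      intro k
      rw [hS, Finset.mem_filter]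
      refine ⟨Finset.mem_univ _, ?_⟩
      rcases sp_mem (i.succAbove k) i with h | h <;> simp [h]
    have h2 := h1.comp (φ := fun r : S → ℂ => fun k : Fin n => (if i.succAbove k < i then (id : ℂ → ℂ) else conj)
        (r ⟨sp (i.succAbove k) i, hmem k⟩))
      (ψ := fun r : ↑(Sᶜ : Finset (Idx (n+1))) → ℂ => fun p : Idx (n+1) => if hp : p ∈ Sᶜ then r ⟨p, hp⟩ else 0)
      (measurable_pi_lambda _ fun k => (mφ k).comp (measurable_pi_apply _))
      (measurable_pi_lambda _ fun p => by
        split_ifs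
        · exact measurable_pi_apply _
        · exact measurable_const)
    have ek : kill (n := n) i = (fun (r : ↑(Sᶜ : Finset (Idx (n+1))) → ℂ) (p : Idx (n+1)) => if hp : p ∈ Sᶜ then r ⟨p, hp⟩ else 0) ∘
        fun (a : Idx (n+1) → ℂ) (i : ↑(Sᶜ : Finset (Idx (n+1)))) => a ↑i := by
     funext x p
     simp only [kill, Function.comp]
     by_cases hpi : p.1.1 = i ∨ p.1.2 = i
     · rw [if_pos hpi, dif_neg]; simp [hS]; tauto
     · rw [if_neg hpi, dif_pos]; simp [hS]; tauto
    rw [ek]; exact h2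
  · have inj : Function.Injective fun k : Fin n => sp (i.succAbove k) i := by
      intro k l hkl
      have hkl : sp (i.succAbove k) i = sp (i.succAbove l) i := hkl
      have e : (sp (i.succAbove k) i).1 = (sp (i.succAbove l) i).1 := by rw [hkl]
      have hk := Fin.succAbove_ne i k
      have hl := Fin.succAbove_ne i l
      refine Fin.succAbove_right_injective (p := i) ?_
      rcases sp_mem (i.succAbove k) i with h | h <;> rcases sp_mem (i.succAbove l) i with h' | h' <;>
        rw [h, h', Prod.mk.injEq] at e
      · exact e.1
      · exact absurd e.1 hk
      · exact absurd e.2 hk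
      · exact e.2
    have h3 := (hI.precomp inj).comp (fun k => if i.succAbove k < i then (id : ℂ → ℂ) else conj) mφ
    have h4 := (iIndepFun_iff_map_fun_eq_pi_map (fun k => ((mφ k).comp (measurable_pi_apply _)).aemeasurable)).1 h3
    refine ⟨_, h4, ?_⟩
    have e1 : ∀ k : Fin n, (Measure.pi μ).map ((if i.succAbove k < i then (id : ℂ → ℂ) else conj) ∘
        fun x : Idx (n+1) → ℂ => x (sp (i.succAbove k) i)) =
        (μ (sp (i.succAbove k) i)).map (if i.succAbove k < i then (id : ℂ → ℂ) else conj) := by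
      intro k
      rw [← Measure.map_map (mφ k) (measurable_pi_apply _)]
      congr 1
      exact (measurePreserving_eval μ _).map_eq
    have hne : ∀ k : Fin n, (sp (i.succAbove k) i).1.1 ≠ (sp (i.succAbove k) i).1.2 := by
      intro k
      rcases sp_mem (i.succAbove k) i with h | h <;> rw [h]
      · exact Fin.succAbove_ne i k
      · exact (Fin.succAbove_ne i k).symm
    refine ⟨fun k => ?_, fun k => ?_⟩
    · rw [e1]
      split_ifs
      · rw [Measure.map_id]; exact h.sub _
      · exact (h.sub _).conj
    · rw [e1]
      split_ifs
      · rw [Measure.map_id]; exact h.var _ (hne k)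
      · exact var_conj (h.var _ (hne k))

end WG
end

noncomputable section
open MeasureTheory ProbabilityTheory
open scoped ENNReal ComplexConjugate

namespace WG

/-- bad event -/
def bad {n : ℕ} (r C3 x0 : ℝ) (i : Fin (n+1)) (k : ℕ) : Set (Idx (n+1) → ℂ) :=
  {x | HS (Rz (minr (Hm x) i) (zz x0 k)) ≤ (Real.sqrt (C3 * (n+1) * 2^k))^2 ∧
    r/3*(n+1) ≤ ‖qf (Rz (minr (Hm x) i) (zz x0 k)) (av x i) - (Rz (minr (Hm x) i) (zz x0 k)).trace‖} ∪
  {x | r/3 ≤ ‖Hm x i i‖}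

theorem bad_prob {δ D : ℝ} (hδ : 0 < δ) (hD : 1 ≤ D) (r C3 : ℝ) (hr : 0 < r) (hC3 : 0 < C3) :
    ∃ C c : ℝ, 0 < C ∧ 0 < c ∧ ∀ (n : ℕ) (μ : Idx (n+1) → Measure ℂ) (_ : Laws δ D (n+1) μ) (x0 : ℝ) (i : Fin (n+1))
      (k : ℕ), Measure.pi μ (bad r C3 x0 i k) ≤ ENNReal.ofReal (C * Real.exp (-(c * Real.sqrt ((n+1) / 2^k)))) := by
  obtain ⟨θ, C, hθ, hC, H⟩ := hw_indep hδ hD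
  refine ⟨C + D, min (θ * (r/3) / Real.sqrt C3) (δ * (r^2/9)), by linarith, by positivity, ?_⟩
  intro n μ hμ x0 i k
  have hp : ∀ p, IsProbabilityMeasure (μ p) := fun p => (hμ.sub p).prob
  set c := min (θ * (r/3) / Real.sqrt C3) (δ * (r^2/9)) with hc
  have hN : (1:ℝ) ≤ n + 1 := by have : (0:ℝ) ≤ n := Nat.cast_nonneg n; linarith
  have h2k : (1:ℝ) ≤ 2^k := one_le_pow₀ (by norm_num)
  set q := Real.sqrt ((n+1) / 2^k) with hq
  have hq0 : 0 ≤ q := Real.sqrt_nonneg _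
  have hq1 : q ≤ n + 1 := by
    rw [hq]
    refine Real.sqrt_le_iff.2 ⟨by linarith, ?_⟩
    rw [div_le_iff₀ (by positivity)]
    nlinarith
  have hqs : (n+1:ℝ) = q^2 * 2^k := by
    rw [hq, Real.sq_sqrt (by positivity)]; field_simp
  obtain ⟨ma, mk', hind, μ', hmap, hsub, hv⟩ := canon_indep hμ i
  have h1 := H (Measure.pi μ) μ' hsub hv _ _ ma mk' hmap hind (fun w => Rz (minr (Hm w) i) (zz x0 k))
    (MM.Rz (fun a b => Hm_MM _ _) _) (Real.sqrt (C3 * (n+1) * 2^k)) (r/3*(n+1)) (by positivity)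
  simp only [minr_kill] at h1
  have h2 : Measure.pi μ {x | r/3 ≤ ‖Hm x i i‖} ≤ ENNReal.ofReal (D * Real.exp (-(δ * (r^2/9) * (n+1)))) := by
    have h3 : ∫⁻ x, ee (δ * ‖x ⟨(i,i), le_rfl⟩‖^2) ∂(Measure.pi μ) ≤ ENNReal.ofReal D := by
      rw [(measurePreserving_eval μ ⟨(i,i), le_rfl⟩).lintegral_comp (f := fun z => ee (δ * ‖z‖^2)) (by fun_prop)]
      exact (hμ.sub _).mom
    have h4 := mul_meas_ge_le_lintegral (μ := Measure.pi μ) (f := fun x : Idx (n+1) → ℂ => ee (δ * ‖x ⟨(i,i), le_rfl⟩‖^2)) (by fun_prop) (ee (δ * (r^2/9) * (n+1)))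
    rw [Real.exp_neg, ← div_eq_mul_inv, ENNReal.ofReal_div_of_pos (Real.exp_pos _)]
    rw [ENNReal.le_div_iff_mul_le (Or.inl (by simp [Real.exp_pos])) (Or.inl ENNReal.ofReal_ne_top), mul_comm]
    refine le_trans (le_trans ?_ h4) h3
    refine mul_le_mul_right (measure_mono fun x hx => ?_) _
    have hx : r/3 ≤ ‖Hm x i i‖ := hx
    refine ee_mono ?_
    rw [mul_assoc]
    refine mul_le_mul_of_nonneg_left ?_ hδ.le
    have h5 : ‖Hm x i i‖ = (Real.sqrt (n+1))⁻¹ * |(x ⟨(i,i), le_rfl⟩).re| := by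
      simp [Hm, abs_of_nonneg (Real.sqrt_nonneg _)]
    rw [h5] at hx
    have h6 := Complex.abs_re_le_norm (x ⟨(i,i), le_rfl⟩)
    have h7 : r/3 * Real.sqrt (n+1) ≤ ‖x ⟨(i,i), le_rfl⟩‖ := by
      refine le_trans ?_ h6
      rwa [← div_eq_inv_mul, le_div_iff₀ (by positivity)] at hx
    calc r^2/9 * (n+1) = (r/3 * Real.sqrt (n+1))^2 := by rw [mul_pow, Real.sq_sqrt (by positivity)]; ring
      _ ≤ _ := by gcongr
  have e1 : θ * (r/3*(n+1)) / Real.sqrt (C3 * (n+1) * 2^k) = θ * (r/3) / Real.sqrt C3 * q := by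
    have : C3 * (n+1) * 2^k = C3 * (q * 2^k)^2 := by rw [hqs]; ring
    have hq0' : 0 < q := by rw [hq]; positivity
    rw [this, Real.sqrt_mul hC3.le, Real.sqrt_sq (by positivity), hqs]
    have := Real.sqrt_pos.2 hC3
    field_simp
  rw [e1] at h1
  refine (measure_union_le _ _).trans ((add_le_add h1 h2).trans ?_)
  rw [← ENNReal.ofReal_add (by positivity) (by positivity), add_mul]
  refine ENNReal.ofReal_le_ofReal (add_le_add ?_ ?_)
  · gcongr
    exact min_le_left _ _
  · gcongr
    exact min_le_right _ _

theorem not_bad {n : ℕ} {r C2 x0 : ℝ} (hr : 0 < r) (hC2 : 1 ≤ C2) {x : Idx (n+1) → ℂ} {i : Fin (n+1)} {k : ℕ}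
    (hk1 : (2:ℝ)^k ≤ n+1) (hk2 : (2:ℝ)^k ≤ r/3 * (n+1))
    (hb : x ∉ bad r (2*C2+1) x0 i k) (hm : (mk (Hm x) x0 k).im ≤ 2*C2) :
    ‖dk (Hm x) x0 i k - (mk (Hm x) x0 k + zz x0 k)‖ ≤ r := by
  have hN : (0:ℝ) < n + 1 := by positivity
  have hNc : ((n:ℂ)+1) ≠ 0 := by exact_mod_cast hN.ne'
  set R := Rz (minr (Hm x) i) (zz x0 k) with hR
  set T := (Rz (Hm x) (zz x0 k)).trace with hT
  have hd : ‖R.trace - T‖ ≤ 2^k := trace_diff (Hm_herm x) x0 i k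
  have hmT : mk (Hm x) x0 k = T / ((n:ℂ)+1) := rfl
  have hTim : T.im = (n+1) * (mk (Hm x) x0 k).im := by
    rw [hmT]
    have : ((n:ℂ)+1) = ((n+1:ℝ):ℂ) := by push_cast; rfl
    rw [this, Complex.div_ofReal_im]; field_simp
  have hRim : R.trace.im ≤ (2*C2+1) * (n+1) := by
    have h1 := (Complex.abs_im_le_norm (R.trace - T)).trans hd
    rw [Complex.sub_im] at h1
    have h2 := (abs_le.1 h1).2
    nlinarith
  have hHS : HS R ≤ (Real.sqrt ((2*C2+1) * (n+1) * 2^k))^2 := by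
    rw [Real.sq_sqrt (by positivity)]
    have := hs_Rz (minr_herm (Hm_herm x) i) (zz_im_pos x0 k)
    unfold HS
    rw [hR, this, zz_im, ← hR, one_div, inv_pow, div_inv_eq_mul]
    gcongr
  have hb1 : ‖qf R (av x i) - R.trace‖ < r/3*(n+1) := by
    by_contra hcon
    exact hb (Or.inl ⟨hHS, not_lt.1 hcon⟩)
  have hb2 : ‖Hm x i i‖ < r/3 := by
    by_contra hcon
    exact hb (Or.inr (not_lt.1 hcon))
  have hq : qf R (colv (Hm x) i) = qf R (av x i) / ((n:ℂ)+1) := by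
    have : colv (Hm x) i = (((Real.sqrt (n+1 : ℕ))⁻¹ : ℝ) : ℂ) • av x i := by
      funext k; rw [colv_av]; rfl
    rw [this]
    unfold qf
    rw [Matrix.mulVec_smul, star_smul, smul_dotProduct, dotProduct_smul, smul_smul]
    have e : star (((Real.sqrt (n+1 : ℕ))⁻¹ : ℝ) : ℂ) * (((Real.sqrt (n+1 : ℕ))⁻¹ : ℝ) : ℂ) = ((n:ℂ)+1)⁻¹ := by
      have : star (((Real.sqrt (n+1 : ℕ))⁻¹ : ℝ) : ℂ) = (((Real.sqrt (n+1 : ℕ))⁻¹ : ℝ) : ℂ) := Complex.conj_ofReal _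
      rw [this, ← Complex.ofReal_mul, ← mul_inv, Real.mul_self_sqrt (by positivity)]
      push_cast; rfl
    rw [e, smul_eq_mul, div_eq_inv_mul]
  have hn : ‖((n:ℂ)+1)‖ = n+1 := by
    have : ((n:ℂ)+1) = ((n+1:ℝ):ℂ) := by push_cast; rfl
    rw [this, Complex.norm_real, Real.norm_of_nonneg hN.le]
  have e : dk (Hm x) x0 i k - (mk (Hm x) x0 k + zz x0 k) =
      (qf R (av x i) - R.trace) / ((n:ℂ)+1) + (R.trace - T) / ((n:ℂ)+1) - Hm x i i := by
    unfold dk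
    rw [← hR, hq, hmT]
    ring
  rw [e]
  refine (norm_sub_le _ _).trans ?_
  have h1 := norm_add_le ((qf R (av x i) - R.trace) / ((n:ℂ)+1)) ((R.trace - T) / ((n:ℂ)+1))
  rw [norm_div, norm_div, hn] at h1
  have h2 : ‖qf R (av x i) - R.trace‖ / (n+1:ℝ) ≤ r/3 := by rw [div_le_iff₀ hN]; exact hb1.le
  have h3 : ‖R.trace - T‖ / (n+1:ℝ) ≤ r/3 := by rw [div_le_iff₀ hN]; exact hd.trans hk2
  linarith

theorem exp_sum_bound (c : ℝ) (hc : 0 < c) (N : ℝ) (J : ℕ) (hY : 1 ≤ N / 2^J) :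
    ∑ k ∈ Finset.range (J+1), (2:ℝ)^(J-k) * Real.exp (-(c * Real.sqrt (N / 2^k))) ≤
      768 / c^4 * Real.exp (-(c/2 * Real.sqrt (N / 2^J))) := by
  set Y := N / 2^J with hYd
  set u := Real.sqrt Y with hu
  have hu1 : 1 ≤ u := Real.one_le_sqrt.2 hY
  have ht : ∀ k ∈ Finset.range (J+1), (2:ℝ)^(J-k) * Real.exp (-(c * Real.sqrt (N / 2^k))) ≤
      384 / c^4 * Real.exp (-(c/2 * u)) * (1/2)^(J-k) := by
    intro k hk
    have hk : k ≤ J := by simpa [Nat.lt_succ_iff] using hk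
    set l := J - k with hl
    have hJ : J = l + k := by omega
    set v := Real.sqrt (2^l) with hv
    have hv1 : 1 ≤ v := Real.one_le_sqrt.2 (one_le_pow₀ (by norm_num))
    have hv2 : v^2 = 2^l := Real.sq_sqrt (by positivity)
    have e1 : Real.sqrt (N / 2^k) = u * v := by
      rw [hu, hv, ← Real.sqrt_mul (by linarith)]
      congr 1
      rw [hYd, hJ, pow_add]; field_simp
    have h1 : (u + v)/2 ≤ u * v := by nlinarith
    set y := c/2 * v with hy
    have hy0 : 0 < y := by positivity
    have h2 : Real.exp (-y) ≤ 24 / y^4 := by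
      rw [Real.exp_neg, ← one_div, div_le_div_iff₀ (Real.exp_pos _) (by positivity)]
      have := Real.pow_div_factorial_le_exp y hy0.le 4
      have e : ((Nat.factorial 4 : ℕ) : ℝ) = 24 := by norm_num [Nat.factorial]
      rw [e] at this
      linarith
    calc (2:ℝ)^l * Real.exp (-(c * Real.sqrt (N / 2^k))) ≤ 2^l * (Real.exp (-(c/2*u)) * Real.exp (-y)) := by
          rw [← Real.exp_add, e1]
          gcongr
          rw [hy]; nlinarith
      _ ≤ 2^l * (Real.exp (-(c/2*u)) * (24 / y^4)) := by gcongr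
      _ = 384 / c^4 * Real.exp (-(c/2 * u)) * (1/2)^l := by
          have e4 : y^4 = c^4/16 * (2^l)^2 := by rw [hy, ← hv2]; ring
          rw [e4, one_div, inv_pow]; field_simp; norm_num
  refine (Finset.sum_le_sum ht).trans ?_
  rw [← Finset.mul_sum]
  have h3 : ∑ k ∈ Finset.range (J+1), (1/2:ℝ)^(J-k) ≤ 2 := by
    have := Finset.sum_range_reflect (fun k => (1/2:ℝ)^k) (J+1)
    simp only [Nat.add_sub_cancel] at this
    rw [this]
    exact sum_geometric_two_le _
  calc _ ≤ 384 / c^4 * Real.exp (-(c/2 * u)) * 2 := by gcongr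
    _ = _ := by ring

theorem local_law {δ D : ℝ} (hδ : 0 < δ) (hD : 1 ≤ D) (q0 : ℝ) (hq0 : 0 < q0) (hq1 : q0 ≤ 1) :
    ∃ c1 C2 K0 C c : ℝ, 0 < c1 ∧ 0 < C2 ∧ 1 ≤ K0 ∧ 0 < C ∧ 0 < c ∧
    ∀ (n : ℕ) (μ : Idx (n+1) → Measure ℂ) (_ : Laws δ D (n+1) μ) (J : ℕ) (x : ℝ) (_ : q0 ≤ 1 - x^2/4)
      (_ : K0 ≤ (n+1) / 2^J),
      Measure.pi μ {y | ¬ ∀ k ≤ J, c1 ≤ (mk (Hm y) x k).im ∧ ‖mk (Hm y) x k‖ ≤ C2} ≤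
        ENNReal.ofReal (C * Real.exp (-(c * Real.sqrt ((n+1) / 2^J)))) := by
  obtain ⟨c1, C2, r, ε, hc1, hC2, hr, hε, B⟩ := boot q0 hq0 hq1
  obtain ⟨C, c, hC, hc, hbad⟩ := bad_prob hδ hD r (2*C2+1) hr (by linarith)
  refine ⟨c1, C2, max 1 (3/r), C * (768/c^4) / ε, c/2, hc1, by linarith, le_max_left _ _, by positivity, by positivity, ?_⟩
  intro n μ hμ J x hx hK
  have hN : (0:ℝ) < n + 1 := by positivity
  have hK1 : (1:ℝ) ≤ (n+1)/2^J := (le_max_left _ _).trans hK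
  have hK2 : 3/r ≤ (n+1:ℝ)/2^J := (le_max_right _ _).trans hK
  rw [le_div_iff₀ (by positivity)] at hK2
  have hJ1 : (2:ℝ)^J ≤ n+1 := by rwa [le_div_iff₀ (by positivity), one_mul] at hK1
  have hJ2 : (2:ℝ)^J ≤ r/3 * (n+1) := by
    have h : r/3 * (3/r * 2^J) ≤ r/3 * (n+1) := by gcongr
    have e : r/3 * (3/r * 2^J) = 2^J := by field_simp
    rwa [e] at h
  set P := Measure.pi μ with hP
  set S : Fin (n+1) → ℕ → Set (Idx (n+1) → ℂ) := fun i k => toMeasurable P (bad r (2*C2+1) x i k) with hS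
  have mS : ∀ i k, MeasurableSet (S i k) := fun i k => measurableSet_toMeasurable _ _
  set b : (Idx (n+1) → ℂ) → Fin (n+1) → ℕ → ℝ := fun y i k => (S i k).indicator (fun _ => (1:ℝ)) y with hb
  have hb0 : ∀ y i k, 0 ≤ b y i k := fun y i k => Set.indicator_nonneg (fun _ _ => zero_le_one) _
  set F : (Idx (n+1) → ℂ) → ℝ≥0∞ := fun y => ∑ i, ∑ k ∈ Finset.range (J+1), ENNReal.ofReal (2^(J-k)) *
    (S i k).indicator (fun _ => (1:ℝ≥0∞)) y with hF
  have hFb : ∀ y, F y = ENNReal.ofReal (∑ i, Sr (b y i) J) := by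
    intro y
    simp only [hF]
    rw [ENNReal.ofReal_sum_of_nonneg (fun i _ => Sr_nonneg (fun k => hb0 y i k) J)]
    refine Finset.sum_congr rfl fun i _ => ?_
    rw [Sr_eq, ENNReal.ofReal_sum_of_nonneg (fun k _ => mul_nonneg (by positivity) (hb0 y i k))]
    refine Finset.sum_congr rfl fun k _ => ?_
    rw [ENNReal.ofReal_mul (by positivity)]
    congr 1
    simp only [hb]
    by_cases h : y ∈ S i k <;> simp [h]
  have mF : Measurable F := by
    refine Finset.measurable_sum _ fun i _ => Finset.measurable_sum _ fun k _ => ?_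
    exact (measurable_const.indicator (mS i k)).const_mul _
  have hint : ∫⁻ y, F y ∂P ≤ ENNReal.ofReal ((n+1) * (C * (768/c^4 * Real.exp (-(c/2 * Real.sqrt ((n+1) / 2^J)))))) := by
    simp only [hF]
    rw [lintegral_finsetSum _ (fun i _ => Finset.measurable_sum _ fun k _ =>
      (measurable_const.indicator (mS i k)).const_mul _)]
    calc _ ≤ ∑ i : Fin (n+1), ENNReal.ofReal (C * (768/c^4 * Real.exp (-(c/2 * Real.sqrt ((n+1) / 2^J))))) := by
          refine Finset.sum_le_sum fun i _ => ?_
          rw [lintegral_finsetSum _ (fun k _ => (measurable_const.indicator (mS i k)).const_mul _)]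
          calc _ ≤ ∑ k ∈ Finset.range (J+1), ENNReal.ofReal (C * (2^(J-k) * Real.exp (-(c * Real.sqrt ((n+1) / 2^k))))) := by
                refine Finset.sum_le_sum fun k _ => ?_
                rw [lintegral_const_mul _ (measurable_const.indicator (mS i k)), lintegral_indicator_const (mS i k), one_mul]
                rw [mul_left_comm, ENNReal.ofReal_mul (by positivity)]
                refine mul_le_mul_right ?_ _
                simp only [hS]
                rw [measure_toMeasurable]
                exact hbad n μ hμ x i k
            _ = ENNReal.ofReal (C * ∑ k ∈ Finset.range (J+1), (2^(J-k) * Real.exp (-(c * Real.sqrt ((n+1) / 2^k))))) := by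
                rw [Finset.mul_sum, ENNReal.ofReal_sum_of_nonneg (fun k _ => by positivity)]
            _ ≤ _ := by
                refine ENNReal.ofReal_le_ofReal (mul_le_mul_of_nonneg_left ?_ hC.le)
                exact exp_sum_bound c hc _ J hK1
      _ = _ := by
          rw [Finset.sum_const, Finset.card_univ, Fintype.card_fin, nsmul_eq_mul, ENNReal.ofReal_mul hN.le]
          congr 1
          rw [← Nat.cast_succ, ENNReal.ofReal_natCast]
  have hmk := mul_meas_ge_le_lintegral (μ := P) mF (ENNReal.ofReal (ε * (n+1)))
  have hsub : {y | ¬ ∀ k ≤ J, c1 ≤ (mk (Hm y) x k).im ∧ ‖mk (Hm y) x k‖ ≤ C2} ⊆ {y | ENNReal.ofReal (ε * (n+1)) ≤ F y} := by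
    intro y hy
    change ENNReal.ofReal (ε * (n+1)) ≤ F y
    by_contra hcon
    apply hy
    refine B n J x hx (Hm y) (Hm_herm y) (b y) (fun i k => hb0 y i k) ?_ ?_
    · intro i k hk hbk hm
      have h2k : (2:ℝ)^k ≤ 2^J := pow_le_pow_right₀ (by norm_num) hk
      refine not_bad hr hC2 (h2k.trans hJ1) (h2k.trans hJ2) ?_ hm
      intro hmem
      have : y ∈ S i k := subset_toMeasurable _ _ hmem
      simp [hb, this] at hbk
    · rw [hFb] at hcon
      by_contra h3
      exact hcon (ENNReal.ofReal_le_ofReal (not_le.1 h3).le)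
  have h4 := (mul_le_mul_right (measure_mono (μ := P) hsub) (ENNReal.ofReal (ε * (n+1)))).trans (hmk.trans hint)
  have e : C * (768/c^4) / ε * Real.exp (-(c/2 * Real.sqrt ((n+1) / 2^J))) =
    ((n+1) * (C * (768/c^4 * Real.exp (-(c/2 * Real.sqrt ((n+1) / 2^J)))))) / (ε * (n+1)) := by field_simp
  rw [e, ENNReal.ofReal_div_of_pos (by positivity)]
  rw [ENNReal.le_div_iff_mul_le (Or.inl (by simp; positivity)) (Or.inl ENNReal.ofReal_ne_top), mul_comm]
  exact h4

end WG
end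

noncomputable section
open MeasureTheory ProbabilityTheory
open scoped ENNReal ComplexConjugate Matrix

namespace WG

theorem net_exists (N : ℕ) : ∃ s : Finset (EuclideanSpace ℂ (Fin N)), s.card ≤ 5 ^ (2 * N) ∧
    (∀ v ∈ s, ‖v‖ = 1) ∧ ∀ u, ‖u‖ = 1 → ∃ v ∈ s, ‖v - u‖ < 1/2 := by
  have hcard : ∀ s : Finset (EuclideanSpace ℂ (Fin N)), (∀ v ∈ s, ‖v‖ = 1) →
      (∀ v ∈ s, ∀ w ∈ s, v ≠ w → 1/2 ≤ ‖v - w‖) → s.card ≤ 5 ^ (2 * N) := by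
    intro s h1 h2
    classical
    have inj : Function.Injective (fun v : EuclideanSpace ℂ (Fin N) => (2:ℝ) • v) :=
      smul_right_injective _ (by norm_num)
    have hfr : Module.finrank ℝ (EuclideanSpace ℂ (Fin N)) = 2 * N := by
      rw [← Module.finrank_mul_finrank ℝ ℂ (EuclideanSpace ℂ (Fin N))]
      simp
    have := Besicovitch.card_le_of_separated (E := EuclideanSpace ℂ (Fin N)) (s.image fun v => (2:ℝ) • v) (by
        intro c hc
        obtain ⟨v, hv, rfl⟩ := Finset.mem_image.1 hc
        rw [norm_smul, h1 v hv]; norm_num) (by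
        intro c hc d hd hne
        obtain ⟨v, hv, rfl⟩ := Finset.mem_image.1 hc
        obtain ⟨w, hw, rfl⟩ := Finset.mem_image.1 hd
        have := h2 v hv w hw (fun h => hne (by rw [h]))
        rw [← smul_sub, norm_smul]; norm_num; linarith)
    rwa [Finset.card_image_of_injective _ inj, hfr] at this
  by_contra hcon
  push Not at hcon
  have key : ∀ m : ℕ, ∃ s : Finset (EuclideanSpace ℂ (Fin N)), s.card = m ∧ (∀ v ∈ s, ‖v‖ = 1) ∧
      (∀ v ∈ s, ∀ w ∈ s, v ≠ w → 1/2 ≤ ‖v - w‖) := by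
    intro m
    induction m with
    | zero => exact ⟨∅, by simp⟩
    | succ m ih =>
      obtain ⟨s, hs, h1, h2⟩ := ih
      obtain ⟨u, hu, hun⟩ := hcon s (hcard s h1 h2) h1
      classical
      refine ⟨insert u s, ?_, ?_, ?_⟩
      · rw [Finset.card_insert_of_notMem, hs]
        intro hus
        have := hun u hus
        simp at this; norm_num at this
      · intro v hv
        rcases Finset.mem_insert.1 hv with rfl | hv
        · exact hu
        · exact h1 v hv
      · intro v hv w hw hne
        rcases Finset.mem_insert.1 hv with hv1 | hv1
        · rcases Finset.mem_insert.1 hw with hw1 | hw1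
          · exact absurd (hv1.trans hw1.symm) hne
          · rw [norm_sub_rev, hv1]; exact hun w hw1
        · rcases Finset.mem_insert.1 hw with hw1 | hw1
          · rw [hw1]; exact hun v hv1
          · exact h2 v hv1 w hw1 hne
  obtain ⟨s, hs, h1, h2⟩ := key (5 ^ (2*N) + 1)
  have := hcard s h1 h2
  omega

theorem net' (N : ℕ) : ∃ s : Finset (Fin N → ℂ), s.card ≤ 5 ^ (2 * N) ∧
    (∀ v ∈ s, ∑ i, ‖v i‖ ^ 2 = 1) ∧ ∀ u : Fin N → ℂ, ∑ i, ‖u i‖ ^ 2 = 1 → ∃ v ∈ s, ∑ i, ‖v i - u i‖ ^ 2 ≤ 1/4 := by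
  classical
  obtain ⟨s, h0, h1, h2⟩ := net_exists N
  refine ⟨s.image fun v => v.ofLp, Finset.card_image_le.trans h0, ?_, ?_⟩
  · intro v hv
    obtain ⟨w, hw, rfl⟩ := Finset.mem_image.1 hv
    rw [← EuclideanSpace.norm_sq_eq, h1 w hw]; norm_num
  · intro u hu
    obtain ⟨v, hv, hvu⟩ := h2 (WithLp.toLp 2 u) (by
      have := EuclideanSpace.norm_sq_eq (𝕜 := ℂ) (WithLp.toLp 2 u)
      simp only [hu] at this
      exact (pow_eq_one_iff_of_nonneg (norm_nonneg _) two_ne_zero).1 this)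
    refine ⟨v.ofLp, Finset.mem_image_of_mem _ hv, ?_⟩
    have := EuclideanSpace.norm_sq_eq (𝕜 := ℂ) (v - WithLp.toLp 2 u)
    simp only [PiLp.sub_apply] at this
    rw [← this]
    have := norm_nonneg (v - WithLp.toLp 2 u)
    nlinarith

theorem unit_sum {n : Type*} [Fintype n] [DecidableEq n] {U : Matrix n n ℂ} (hU : U * Uᴴ = 1) (v : n → ℂ) :
    ∑ a, ‖(Uᴴ *ᵥ v) a‖ ^ 2 = ∑ a, ‖v a‖ ^ 2 := by
  have h := qf_diag U (fun _ => 1) v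
  have h1 := qf_diag (1 : Matrix n n ℂ) (fun _ => 1) v
  have e : Matrix.diagonal (fun _ : n => (1:ℂ)) = 1 := Matrix.diagonal_one
  rw [e] at h h1
  simp only [mul_one, hU, Matrix.conjTranspose_one, Matrix.one_mulVec] at h h1
  rw [h] at h1
  exact_mod_cast h1

theorem det_net {N : ℕ} {A : Matrix (Fin N) (Fin N) ℂ} (hA : A.IsHermitian) {s : Finset (Fin N → ℂ)}
    (h1 : ∀ v ∈ s, ∑ i, ‖v i‖ ^ 2 = 1)
    (h2 : ∀ u : Fin N → ℂ, ∑ i, ‖u i‖ ^ 2 = 1 → ∃ v ∈ s, ∑ i, ‖v i - u i‖ ^ 2 ≤ 1/4) {t : ℝ} (ht : 0 ≤ t)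
    (h : ∃ i, t ≤ |hA.eigenvalues i|) : ∃ v ∈ s, t / 2 ≤ |(qf A v).re| := by
  obtain ⟨i1, hi1⟩ := h
  obtain ⟨i0, -, hi0⟩ := Finset.exists_max_image Finset.univ (fun i => |hA.eigenvalues i|) ⟨i1, Finset.mem_univ _⟩
  obtain ⟨U, hU, hU', hAU⟩ := spec hA
  set l := hA.eigenvalues with hl
  set e : Fin N → ℂ := Pi.single i0 1 with he
  have hee : Uᴴ *ᵥ (U *ᵥ e) = e := by rw [Matrix.mulVec_mulVec, hU', Matrix.one_mulVec]
  have hu1 : ∑ i, ‖(U *ᵥ e) i‖ ^ 2 = 1 := by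
    rw [← unit_sum hU, hee, he, Finset.sum_eq_single i0]
    · simp
    · intro b _ hb; simp [hb]
    · simp
  obtain ⟨v, hv, hvu⟩ := h2 _ hu1
  refine ⟨v, hv, ?_⟩
  set w := Uᴴ *ᵥ v with hw
  have hw1 : ∑ a, ‖w a‖ ^ 2 = 1 := by rw [hw, unit_sum hU, h1 v hv]
  have hwe : ∑ a, ‖w a - e a‖ ^ 2 ≤ 1/4 := by
    have := unit_sum hU (v - U *ᵥ e)
    rw [Matrix.mulVec_sub, hee] at this
    simp only [Pi.sub_apply] at this
    rw [this]; exact hvu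
  have split1 := Finset.add_sum_erase Finset.univ (fun a => ‖w a‖ ^ 2) (Finset.mem_univ i0)
  have split2 := Finset.add_sum_erase Finset.univ (fun a => ‖w a - e a‖ ^ 2) (Finset.mem_univ i0)
  have heq : ∑ a ∈ Finset.univ.erase i0, ‖w a - e a‖ ^ 2 = ∑ a ∈ Finset.univ.erase i0, ‖w a‖ ^ 2 := by
    refine Finset.sum_congr rfl fun a ha => ?_
    simp [he, Finset.ne_of_mem_erase ha]
  rw [heq] at split2
  have h3 : ‖w i0 - e i0‖ ^ 2 = ‖w i0‖ ^ 2 - 2 * (w i0).re + 1 := by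
    simp only [he, Pi.single_eq_same]
    rw [← Complex.normSq_eq_norm_sq, ← Complex.normSq_eq_norm_sq, Complex.normSq_apply, Complex.normSq_apply]
    simp; ring
  have hre : 7/8 ≤ (w i0).re := by linarith
  have hno : 49/64 ≤ ‖w i0‖ ^ 2 := by
    have := Complex.re_le_norm (w i0)
    nlinarith
  have hq : (qf A v).re = ∑ a, ‖w a‖ ^ 2 * l a := by
    conv_lhs => rw [hAU]
    rw [qf_diag, Complex.re_sum]
    refine Finset.sum_congr rfl fun a _ => ?_
    rw [← Complex.ofReal_mul, Complex.ofReal_re]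
  rw [hq, ← Finset.add_sum_erase _ _ (Finset.mem_univ i0)]
  have hrest : |∑ a ∈ Finset.univ.erase i0, ‖w a‖ ^ 2 * l a| ≤ |l i0| * ∑ a ∈ Finset.univ.erase i0, ‖w a‖ ^ 2 := by
    refine (Finset.abs_sum_le_sum_abs _ _).trans ?_
    rw [Finset.mul_sum]
    refine Finset.sum_le_sum fun a _ => ?_
    rw [abs_mul, abs_of_nonneg (by positivity), mul_comm]
    exact mul_le_mul_of_nonneg_right (hi0 a (Finset.mem_univ _)) (by positivity)
  have hr : ∑ a ∈ Finset.univ.erase i0, ‖w a‖ ^ 2 = 1 - ‖w i0‖ ^ 2 := by linarith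
  rw [hr] at hrest
  have h4 := abs_sub_abs_le_abs_add (‖w i0‖ ^ 2 * l i0) (∑ a ∈ Finset.univ.erase i0, ‖w a‖ ^ 2 * l a)
  rw [abs_mul, abs_of_nonneg (by positivity : 0 ≤ ‖w i0‖ ^ 2)] at h4
  have h5 : t ≤ |l i0| := hi1.trans (hi0 i1 (Finset.mem_univ _))
  nlinarith

def cof {N : ℕ} (v : Fin N → ℂ) (p : Idx N) : ℂ :=
  (if p.1.1 = p.1.2 then 1 else 2) * (conj (v p.1.1) * v p.1.2)

theorem idx_sum {N : ℕ} (F : Fin N × Fin N → ℝ) : ∑ p : Idx N, F p.1 = ∑ i, ∑ j, if i ≤ j then F (i, j) else 0 := by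
  rw [← Fintype.sum_prod_type' (f := fun i j => if i ≤ j then F (i, j) else 0), ← Finset.sum_filter]
  exact (Finset.sum_subtype _ (by simp) _).symm

theorem cof_sq {N : ℕ} (v : Fin N → ℂ) (hv : ∑ i, ‖v i‖ ^ 2 = 1) : ∑ p, ‖cof v p‖ ^ 2 ≤ 4 := by
  have h1 : ∀ p : Idx N, ‖cof v p‖ ^ 2 ≤ 4 * (‖v p.1.1‖ ^ 2 * ‖v p.1.2‖ ^ 2) := by
    intro p
    unfold cof
    rw [norm_mul, norm_mul, RCLike.norm_conj, mul_pow, mul_pow]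
    refine mul_le_mul_of_nonneg_right ?_ (by positivity)
    split_ifs <;> norm_num
  refine (Finset.sum_le_sum fun p _ => h1 p).trans ?_
  rw [idx_sum (fun p => 4 * (‖v p.1‖ ^ 2 * ‖v p.2‖ ^ 2))]
  calc _ ≤ ∑ i, ∑ j, 4 * (‖v i‖ ^ 2 * ‖v j‖ ^ 2) := by
        refine Finset.sum_le_sum fun i _ => Finset.sum_le_sum fun j _ => ?_
        split_ifs
        · rfl
        · positivity
    _ = 4 := by simp_rw [← Finset.mul_sum, hv, mul_one, hv]; norm_num

theorem qf_Hm {N : ℕ} (v : Fin N → ℂ) (y : Idx N → ℂ) :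
    (qf (Hm y) v).re = (Real.sqrt N)⁻¹ * (∑ p, cof v p * y p).re := by
  set a : Fin N → Fin N → ℝ := fun i j => (conj (v i) * (Hm y i j * v j)).re with ha
  have hsym : ∀ i j, a j i = a i j := by
    intro i j
    simp only [ha]
    have hH : Hm y j i = conj (Hm y i j) := by
      have := (Hm_herm y).apply j i
      exact this.symm
    rw [hH, ← Complex.conj_re]
    congr 1
    simp; ring
  have h1 : (qf (Hm y) v).re = ∑ i, ∑ j, a i j := by
    unfold qf dotProduct Matrix.mulVec dotProduct
    rw [Complex.re_sum]
    refine Finset.sum_congr rfl fun i _ => ?_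
    rw [Finset.mul_sum, Complex.re_sum]
    rfl
  have h2 : ∑ i, ∑ j, a i j = ∑ i, ∑ j, if i ≤ j then (if i = j then 1 else 2) * a i j else 0 := by
    have e1 : ∑ i, ∑ j, a i j = ∑ i, ∑ j, (if i ≤ j then a i j else 0) + ∑ i, ∑ j, (if j < i then a i j else 0) := by
      simp_rw [← Finset.sum_add_distrib]
      refine Finset.sum_congr rfl fun i _ => Finset.sum_congr rfl fun j _ => ?_
      rcases le_or_gt i j with h | h
      · simp [h, not_lt.2 h]
      · simp [h, not_le.2 h]
    rw [e1, Finset.sum_comm (f := fun i j => if j < i then a i j else 0)]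
    simp_rw [← Finset.sum_add_distrib]
    refine Finset.sum_congr rfl fun i _ => Finset.sum_congr rfl fun j _ => ?_
    rw [hsym]
    rcases lt_trichotomy i j with h | h | h
    · simp [h, h.le, h.ne]; ring
    · simp [h]
    · simp [not_le.2 h, not_lt.2 h.le]
  rw [h1, h2, ← idx_sum (fun p => (if p.1 = p.2 then 1 else 2) * a p.1 p.2), Complex.re_sum, Finset.mul_sum]
  refine Finset.sum_congr rfl fun p _ => ?_
  obtain ⟨⟨i, j⟩, hp⟩ := p
  simp only [ha, cof]
  rcases lt_or_eq_of_le hp with h | h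
  · simp only at h
    have : Hm y i j = (((Real.sqrt N)⁻¹ : ℝ) : ℂ) * y ⟨(i, j), hp⟩ := by unfold Hm; simp [h]
    rw [this, if_neg h.ne, if_neg h.ne,
      show conj (v i) * ((((Real.sqrt N)⁻¹ : ℝ) : ℂ) * y ⟨(i, j), hp⟩ * v j) =
        (((Real.sqrt N)⁻¹ : ℝ) : ℂ) * (conj (v i) * v j * y ⟨(i, j), hp⟩) by ring, Complex.re_ofReal_mul,
      show (2:ℂ) * (conj (v i) * v j) * y ⟨(i, j), hp⟩ = ((2:ℝ):ℂ) * (conj (v i) * v j * y ⟨(i, j), hp⟩) by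
        push_cast; ring, Complex.re_ofReal_mul]
    ring
  · simp only at h
    subst h
    have : Hm y i i = (((Real.sqrt N)⁻¹ : ℝ) : ℂ) * ((y ⟨(i, i), hp⟩).re : ℂ) := by unfold Hm; simp
    have hc : conj (v i) * v i = ((‖v i‖ ^ 2 : ℝ) : ℂ) := by
      rw [mul_comm, Complex.mul_conj, Complex.normSq_eq_norm_sq]
    rw [this, if_pos rfl, if_pos rfl,
      show conj (v i) * ((((Real.sqrt N)⁻¹ : ℝ) : ℂ) * ((y ⟨(i, i), hp⟩).re : ℂ) * v i) =
        (((Real.sqrt N)⁻¹ : ℝ) : ℂ) * ((conj (v i) * v i) * ((y ⟨(i, i), hp⟩).re : ℂ)) by ring, hc, one_mul, one_mul,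
      Complex.re_ofReal_mul, Complex.re_ofReal_mul, Complex.re_ofReal_mul, Complex.ofReal_re]

theorem qf_tail1 {δ D : ℝ} (hδ : 0 < δ) (hD : 1 ≤ D) {N : ℕ} (hN : 0 < N) (μ : Idx N → Measure ℂ)
    (h : ∀ p, SubG δ D (μ p)) (c : Idx N → ℂ) (hc : ∑ p, ‖c p‖ ^ 2 ≤ 4) (t : ℝ) (ht : 0 ≤ t) :
    Measure.pi μ {y | t / 2 ≤ (Real.sqrt N)⁻¹ * (∑ p, c p * y p).re} ≤ ee (-(N * t ^ 2 / (64 * (D / δ)))) := by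
  have hB : 0 < D / δ := by positivity
  have hs : 0 < Real.sqrt N := by positivity
  have hss : Real.sqrt N * Real.sqrt N = N := Real.mul_self_sqrt (by positivity)
  set B := D / δ with hBd
  set σ : ℝ := Real.sqrt N * t / (16 * B) with hσ
  have hσ0 : 0 ≤ σ := by positivity
  have hl := lin_mgf hδ hD μ h (fun p => (σ : ℂ) * c p)
  have hre : ∀ y : Idx N → ℂ, (∑ p, (σ : ℂ) * c p * y p).re = σ * (∑ p, c p * y p).re := by
    intro y
    rw [← Complex.re_ofReal_mul, Finset.mul_sum]
    simp_rw [mul_assoc]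
  simp_rw [hre] at hl
  have hle : B * ∑ p, ‖(σ : ℂ) * c p‖ ^ 2 ≤ B * (σ ^ 2 * 4) := by
    simp_rw [norm_mul, mul_pow, ← Finset.mul_sum, Complex.norm_real, Real.norm_eq_abs, sq_abs]
    gcongr
  have hl2 := hl.trans (ee_mono hle)
  have hmeas : Measurable fun y : Idx N → ℂ => ee (σ * (∑ p, c p * y p).re) :=
    ee_meas' (by fun_prop)
  have hm := mul_meas_ge_le_lintegral (μ := Measure.pi μ) hmeas (ee (σ * (Real.sqrt N * t / 2)))
  have hsub : Measure.pi μ {y | t / 2 ≤ (Real.sqrt N)⁻¹ * (∑ p, c p * y p).re} ≤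
      Measure.pi μ {y | ee (σ * (Real.sqrt N * t / 2)) ≤ ee (σ * (∑ p, c p * y p).re)} := by
    refine measure_mono fun y hy => ?_
    simp only [Set.mem_ofPred_eq] at hy ⊢
    refine ee_mono (mul_le_mul_of_nonneg_left ?_ hσ0)
    rw [inv_mul_eq_div, le_div_iff₀ hs] at hy
    linarith
  have h3 : ee (σ * (Real.sqrt N * t / 2)) * Measure.pi μ {y | t / 2 ≤ (Real.sqrt N)⁻¹ * (∑ p, c p * y p).re} ≤
      ee (B * (σ ^ 2 * 4)) := (mul_le_mul_right hsub _).trans (hm.trans hl2)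
  have h4 : ee (-(σ * (Real.sqrt N * t / 2))) * ee (σ * (Real.sqrt N * t / 2)) = 1 := by
    rw [← ee_add, neg_add_cancel, ee_zero]
  calc _ = ee (-(σ * (Real.sqrt N * t / 2))) * (ee (σ * (Real.sqrt N * t / 2)) * Measure.pi μ {y | t / 2 ≤ (Real.sqrt N)⁻¹ * (∑ p, c p * y p).re}) := by
        rw [← mul_assoc, h4, one_mul]
    _ ≤ ee (-(σ * (Real.sqrt N * t / 2))) * ee (B * (σ ^ 2 * 4)) := mul_le_mul_right h3 _
    _ = _ := by
        rw [← ee_add]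
        congr 1
        have hsq : Real.sqrt N ^ 2 = N := by rw [sq, hss]
        rw [hσ]
        field_simp
        rw [hsq]
        ring

theorem qf_tail {δ D : ℝ} (hδ : 0 < δ) (hD : 1 ≤ D) {N : ℕ} (hN : 0 < N) (μ : Idx N → Measure ℂ)
    (h : ∀ p, SubG δ D (μ p)) (v : Fin N → ℂ) (hv : ∑ i, ‖v i‖ ^ 2 = 1) (t : ℝ) (ht : 0 ≤ t) :
    Measure.pi μ {y | t / 2 ≤ |(qf (Hm y) v).re|} ≤ 2 * ee (-(N * t ^ 2 / (64 * (D / δ)))) := by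
  have h1 := qf_tail1 hδ hD hN μ h (cof v) (cof_sq v hv) t ht
  have h2 := qf_tail1 hδ hD hN μ h (fun p => - cof v p) (by simpa using cof_sq v hv) t ht
  rw [two_mul]
  refine le_trans ?_ (add_le_add h1 h2)
  refine (measure_mono ?_).trans (measure_union_le _ _)
  intro y hy
  simp only [Set.mem_ofPred_eq, qf_Hm] at hy
  rcases le_abs.1 hy with hy | hy
  · exact Or.inl hy
  · refine Or.inr ?_
    simp only [Set.mem_ofPred_eq, neg_mul, Finset.sum_neg_distrib, Complex.neg_re, mul_neg]
    exact hy

theorem norm_bound {δ D : ℝ} (hδ : 0 < δ) (hD : 1 ≤ D) {N : ℕ} (hN : 0 < N) (μ : Idx N → Measure ℂ)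
    (h : ∀ p, SubG δ D (μ p)) (t : ℝ) (ht : 0 ≤ t) :
    Measure.pi μ {y | ∃ i, t ≤ |(Hm_herm y).eigenvalues i|} ≤
      ENNReal.ofReal (2 * Real.exp (4 * N - N * t ^ 2 / (64 * (D / δ)))) := by
  obtain ⟨s, h0, h1, h2⟩ := net' N
  calc _ ≤ Measure.pi μ (⋃ v ∈ s, {y | t / 2 ≤ |(qf (Hm y) v).re|}) := by
        refine measure_mono fun y hy => ?_
        obtain ⟨v, hv, hq⟩ := det_net (Hm_herm y) h1 h2 ht hy
        exact Set.mem_biUnion hv hq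
    _ ≤ ∑ v ∈ s, Measure.pi μ {y | t / 2 ≤ |(qf (Hm y) v).re|} := measure_biUnion_finset_le _ _
    _ ≤ ∑ v ∈ s, 2 * ee (-(N * t ^ 2 / (64 * (D / δ)))) :=
        Finset.sum_le_sum fun v hv => qf_tail hδ hD hN μ h v (h1 v hv) t ht
    _ = ENNReal.ofReal ((s.card : ℝ) * (2 * Real.exp (-(N * t ^ 2 / (64 * (D / δ)))))) := by
        rw [Finset.sum_const, nsmul_eq_mul, ENNReal.ofReal_mul (by positivity), ENNReal.ofReal_mul (by positivity)]
        simp [ee]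
    _ ≤ _ := by
        refine ENNReal.ofReal_le_ofReal ?_
        have h5 : (5:ℝ) ≤ Real.exp 2 := by
          have h := Real.exp_one_gt_d9
          rw [show (2:ℝ) = 1 + 1 by norm_num, Real.exp_add]
          nlinarith
        have : (s.card : ℝ) ≤ Real.exp (4 * N) := by
          calc (s.card : ℝ) ≤ (5:ℝ) ^ (2 * N) := by exact_mod_cast h0
            _ ≤ (Real.exp 2) ^ (2 * N) := by gcongr
            _ = _ := by rw [← Real.exp_nat_mul]; congr 1; push_cast; ring
        rw [sub_eq_add_neg, Real.exp_add]
        calc _ ≤ Real.exp (4 * N) * (2 * Real.exp (-(N * t ^ 2 / (64 * (D / δ))))) := by gcongr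
          _ = _ := by ring

end WG
end

noncomputable section
open MeasureTheory ProbabilityTheory
open scoped ENNReal ComplexConjugate Matrix

namespace WG

/-- the gap event -/
def gapEv {N : ℕ} {A : Matrix (Fin N) (Fin N) ℂ} (hA : A.IsHermitian) (E L : ℝ) : Prop :=
  (∃ i, hA.eigenvalues i < E) ∧ (∃ i, E ≤ hA.eigenvalues i) ∧
    ∀ i, E ≤ hA.eigenvalues i → E + L ≤ hA.eigenvalues i

theorem mk_im_eq {n : ℕ} {A : Matrix (Fin (n+1)) (Fin (n+1)) ℂ} (hA : A.IsHermitian) (x : ℝ) (k : ℕ) :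
    (mk A x k).im = ∑ a, (n+1:ℝ)⁻¹ * (((1/2:ℝ)^k) / ((hA.eigenvalues a - x)^2 + ((1/2:ℝ)^k)^2)) := by
  rw [mk_eq hA, Complex.im_sum]
  refine Finset.sum_congr rfl fun a _ => ?_
  rw [Complex.im_ofReal_mul, inv_im, zz_im, ← Complex.normSq_eq_norm_sq, Complex.normSq_apply]
  congr 2
  rw [Complex.sub_re, Complex.sub_im, zz_re, zz_im, Complex.ofReal_re, Complex.ofReal_im]
  ring

theorem det_gap {n : ℕ} {A : Matrix (Fin (n+1)) (Fin (n+1)) ℂ} (hA : A.IsHermitian) {E L : ℝ} (hL : 0 < L)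
    (h : ∀ i, E ≤ hA.eigenvalues i → E + L ≤ hA.eigenvalues i) (q s : ℕ) (hq : (1/2:ℝ)^q ≤ L/2) :
    (mk A (E + L/2) (q+s)).im ≤ 2 * (1/2:ℝ)^s * (mk A (E + L/2) q).im := by
  rw [mk_im_eq hA, mk_im_eq hA, Finset.mul_sum]
  refine Finset.sum_le_sum fun a _ => ?_
  set η := (1/2:ℝ)^q with hη
  have hη0 : 0 < η := by positivity
  set σ := (1/2:ℝ)^s with hσ
  have hσ0 : 0 < σ := by positivity
  rw [pow_add, ← hη, ← hσ]
  set d := (hA.eigenvalues a - (E + L/2))^2 with hd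
  have hdL : η^2 ≤ d := by
    rcases lt_or_ge (hA.eigenvalues a) E with h1 | h1
    · rw [hd]; nlinarith
    · have := h a h1
      rw [hd]; nlinarith
  have hd0 : 0 < d := lt_of_lt_of_le (by positivity) hdL
  have : η * σ / (d + (η*σ)^2) ≤ 2 * σ * (η / (d + η^2)) := by
    calc η * σ / (d + (η*σ)^2) ≤ η * σ / ((d + η^2)/2) := by
          apply div_le_div_of_nonneg_left (by positivity) (by positivity)
          nlinarith [sq_nonneg (η*σ)]
      _ = _ := by field_simp
  calc _ ≤ (n+1:ℝ)⁻¹ * (2 * σ * (η / (d + η^2))) := by gcongr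
    _ = _ := by ring

theorem mid {κ δ D : ℝ} (hκ : 0 < κ) (hδ : 0 < δ) (hD : 1 ≤ D) :
    ∃ K1 C c : ℝ, 1 ≤ K1 ∧ 0 < C ∧ 0 < c ∧
    ∀ (n : ℕ) (μ : Idx (n+1) → Measure ℂ) (_ : Laws δ D (n+1) μ) (E : ℝ) (_ : E ∈ Set.Icc (-2+κ) (2-κ))
      (K : ℝ) (_ : K1 ≤ K) (_ : K ≤ min κ 1 * (n+1)),
      Measure.pi μ {y | gapEv (Hm_herm y) E (K/(n+1))} ≤ ENNReal.ofReal (C * Real.exp (-(c * Real.sqrt K))) := by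
  have hm0 : 0 < min κ 1 := lt_min hκ one_pos
  obtain ⟨c1, C2, K0, C, c, hc1, hC2, hK0, hC, hc, LL⟩ := local_law hδ hD (min κ 1 / 4) (by positivity)
    (by linarith [min_le_right κ 1])
  obtain ⟨s, hs⟩ := exists_pow_lt_of_lt_one (show 0 < c1 / (2 * C2) by positivity) (show (1/2:ℝ) < 1 by norm_num)
  have hs' : 2 * (1/2:ℝ)^s * C2 < c1 := by
    rw [lt_div_iff₀ (by positivity)] at hs; linarith
  refine ⟨K0 * 2^(s+2), C, c * Real.sqrt ((1/2:ℝ)^(s+2)), ?_, hC, by positivity, ?_⟩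
  · have : (1:ℝ) ≤ 2^(s+2) := one_le_pow₀ (by norm_num)
    nlinarith
  intro n μ hμ E hE K hK1 hK2
  have hn : (0:ℝ) < n+1 := by positivity
  have hK : 0 < K := lt_of_lt_of_le (by positivity) hK1
  set L := K/(n+1) with hLd
  have hL : 0 < L := by positivity
  have hLm : L ≤ min κ 1 := by rw [hLd, div_le_iff₀ hn]; exact hK2
  have hLκ : L ≤ κ := hLm.trans (min_le_left _ _)
  have hL1 : L ≤ 1 := hLm.trans (min_le_right _ _)
  obtain ⟨m, hm1, hm2⟩ := exists_nat_pow_near_of_lt_one (show 0 < L/2 by positivity) (by linarith)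
    (show (0:ℝ) < 1/2 by norm_num) (by norm_num)
  have hm3 : L/4 ≤ (1/2:ℝ)^(m+1) := by rw [pow_succ]; linarith
  have hJ : K * (1/2:ℝ)^(s+2) ≤ (n+1) / 2^(m+1+s) := by
    have e1 : ((n:ℝ)+1) / 2^(m+1+s) = (n+1) * ((1/2:ℝ)^(m+1) * (1/2:ℝ)^s) := by
      rw [← pow_add, div_pow, one_pow]; field_simp
    have e2 : K = L * (n+1) := by rw [hLd]; field_simp
    rw [e1, e2]
    have e3 : L * (1/2:ℝ)^(s+2) = L/4 * (1/2:ℝ)^s := by rw [pow_add]; ring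
    calc L * (n+1) * (1/2:ℝ)^(s+2) = (n+1) * (L/4 * (1/2:ℝ)^s) := by rw [← e3]; ring
      _ ≤ _ := by gcongr
  have hJ0 : K0 ≤ (n+1) / 2^(m+1+s) := by
    refine le_trans ?_ hJ
    calc K0 = K0 * 2^(s+2) * (1/2:ℝ)^(s+2) := by rw [div_pow, one_pow]; field_simp
      _ ≤ _ := by gcongr
  have hx : min κ 1 / 4 ≤ 1 - (E + L/2)^2/4 := by
    obtain ⟨hE1, hE2⟩ := hE
    have hκ2 : κ ≤ 2 := by linarith
    have := min_le_left κ 1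
    have h1 : (E + L/2)^2 ≤ (2 - κ/2)^2 := by
      apply sq_le_sq' <;> linarith
    nlinarith
  refine le_trans (measure_mono ?_) ((LL n μ hμ (m+1+s) (E+L/2) hx hJ0).trans ?_)
  · intro y hy hall
    have h1 := (hall (m+1+s) le_rfl).1
    have h2 := (hall (m+1) (by omega)).2
    have h3 := det_gap (Hm_herm y) hL hy.2.2 (m+1) s hm1.le
    have h4 := (Complex.abs_im_le_norm _).trans h2
    have h5 := (le_abs_self _).trans h4
    have h6 : 2 * (1/2:ℝ)^s * (mk (Hm y) (E+L/2) (m+1)).im ≤ 2 * (1/2:ℝ)^s * C2 := by gcongr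
    linarith
  · refine ENNReal.ofReal_le_ofReal ?_
    have : c * Real.sqrt ((1/2:ℝ)^(s+2)) * Real.sqrt K ≤ c * Real.sqrt ((n+1) / 2^(m+1+s)) := by
      rw [mul_assoc, ← Real.sqrt_mul (by positivity), mul_comm _ K]
      gcongr
    gcongr

theorem canon {κ δ D : ℝ} (hκ : 0 < κ) (hδ : 0 < δ) (hD : 1 ≤ D) :
    ∃ C c : ℝ, 0 < C ∧ 0 < c ∧
    ∀ (n : ℕ) (μ : Idx (n+1) → Measure ℂ) (_ : Laws δ D (n+1) μ) (E : ℝ) (_ : E ∈ Set.Icc (-2+κ) (2-κ))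
      (K : ℝ) (_ : 0 ≤ K),
      Measure.pi μ {y | gapEv (Hm_herm y) E (K/(n+1))} ≤ ENNReal.ofReal (C * Real.exp (-(c * Real.sqrt K))) := by
  obtain ⟨K1, Cm, cm, hK1, hCm, hcm, M⟩ := mid hκ hδ hD
  have hm0 : 0 < min κ 1 := lt_min hκ one_pos
  set m := min κ 1 with hm
  have hm1 : m ≤ 1 := min_le_right _ _
  have hB : 0 < D/δ := by positivity
  set B := D/δ with hBd
  set A := 1024 * B + 4 with hA
  have hA4 : 4 < A := by rw [hA]; linarith
  set K2 := A * K1 / m with hK2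
  have hK12 : K1 ≤ K2 := by
    rw [hK2, le_div_iff₀ hm0]; nlinarith
  set c := min 1 (cm * Real.sqrt (m/A)) with hc
  have hsm : 0 < Real.sqrt (m/A) := by positivity
  have hc0 : 0 < c := lt_min one_pos (by positivity)
  have hc1 : c ≤ 1 := min_le_left _ _
  have hc2 : c ≤ cm * Real.sqrt (m/A) := min_le_right _ _
  have hc3 : c ≤ cm := by
    refine hc2.trans ?_
    have : Real.sqrt (m/A) ≤ 1 := by
      rw [Real.sqrt_le_one, div_le_one (by linarith)]; linarith
    nlinarith
  set C := Cm + Real.exp (Real.sqrt K2) + 2 with hC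
  have hexp := Real.exp_pos (Real.sqrt K2)
  refine ⟨C, c, by positivity, hc0, ?_⟩
  intro n μ hμ E hE K hK
  have : ∀ p, IsProbabilityMeasure (μ p) := fun p => (hμ.sub p).prob
  have hn : (0:ℝ) < n+1 := by positivity
  have hn1 : (1:ℝ) ≤ n+1 := by linarith [(Nat.cast_nonneg n : (0:ℝ) ≤ n)]
  have hsK := Real.sqrt_nonneg K
  rcases le_or_gt K K2 with h2 | h2
  · refine prob_le_one.trans ?_
    rw [← ENNReal.ofReal_one]
    refine ENNReal.ofReal_le_ofReal ?_
    have hle : Real.sqrt K ≤ Real.sqrt K2 := Real.sqrt_le_sqrt h2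
    calc (1:ℝ) = Real.exp (Real.sqrt K2) * Real.exp (-Real.sqrt K2) := by rw [← Real.exp_add]; simp
      _ ≤ C * Real.exp (-(c * Real.sqrt K)) := by
        gcongr
        · rw [hC]; linarith
        · nlinarith
  have hKK1 : K1 < K := lt_of_le_of_lt hK12 h2
  rcases le_or_gt K (m * (n+1)) with h3 | h3
  · refine (M n μ hμ E hE K hKK1.le h3).trans (ENNReal.ofReal_le_ofReal ?_)
    gcongr
    rw [hC]; linarith
  rcases le_or_gt K (A * (n+1)) with h4 | h4
  · have h5 : K1 ≤ m * (n+1) := by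
      have : A * K1 / m < A * (n+1) := lt_of_lt_of_le h2 h4
      rw [div_lt_iff₀ hm0] at this
      nlinarith
    refine le_trans (measure_mono ?_) ((M n μ hμ E hE (m * (n+1)) h5 le_rfl).trans (ENNReal.ofReal_le_ofReal ?_))
    · intro y hy
      refine ⟨hy.1, hy.2.1, fun i hi => le_trans ?_ (hy.2.2 i hi)⟩
      gcongr
    · have h6 : Real.sqrt (m/A) * Real.sqrt K ≤ Real.sqrt (m * (n+1)) := by
        rw [← Real.sqrt_mul (by positivity)]
        refine Real.sqrt_le_sqrt ?_
        rw [div_mul_eq_mul_div, div_le_iff₀ (by linarith)]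
        nlinarith
      have h7 : c * Real.sqrt K ≤ cm * Real.sqrt (m * (n+1)) := by
        calc c * Real.sqrt K ≤ cm * Real.sqrt (m/A) * Real.sqrt K := by gcongr
          _ = cm * (Real.sqrt (m/A) * Real.sqrt K) := by ring
          _ ≤ _ := by gcongr
      gcongr
      rw [hC]; linarith
  · set t := K / (2 * (n+1)) with ht
    have htK : K = 2 * (n+1) * t := by rw [ht]; field_simp
    have hκ2 : κ ≤ 2 := by linarith [hE.1, hE.2]
    have htA : A < 2 * t := by
      rw [htK] at h4; nlinarith
    have ht0 : 0 ≤ t := by linarith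
    have hN := norm_bound hδ hD (Nat.succ_pos n) μ hμ.sub t ht0
    refine le_trans (measure_mono ?_) (hN.trans (ENNReal.ofReal_le_ofReal ?_))
    · intro y hy
      obtain ⟨i, hi⟩ := hy.2.1
      refine ⟨i, le_trans ?_ (le_abs_self _)⟩
      refine le_trans ?_ (hy.2.2 i hi)
      have : K/(n+1) = 2 * t := by rw [ht]; field_simp
      rw [this]
      linarith [hE.1]
    · have h8 : Real.sqrt K ≤ K := by
        have hK1' : 1 ≤ K := by linarith
        rw [Real.sqrt_le_left hK]; nlinarith
      have h9 : 4 + 2 * t ≤ t^2 / (64 * B) := by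
        rw [le_div_iff₀ (by positivity)]
        rw [hA] at htA
        nlinarith
      have h10 : 4 * ((n+1 : ℕ):ℝ) - ((n+1:ℕ):ℝ) * t^2 / (64 * B) ≤ -(c * Real.sqrt K) := by
        push_cast
        have : ((n:ℝ)+1) * (4 + 2 * t) ≤ (n+1) * (t^2 / (64 * B)) := by gcongr
        have e : ((n:ℝ)+1) * t^2 / (64 * B) = (n+1) * (t^2 / (64 * B)) := by ring
        rw [e]
        nlinarith
      have h11 : 2 ≤ C := by rw [hC]; linarith
      calc _ ≤ 2 * Real.exp (-(c * Real.sqrt K)) := by gcongr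
        _ ≤ _ := by gcongr

end WG
end

namespace WG

theorem transfer {Ω : Type} [MeasurableSpace Ω] {P : Measure Ω} {N : ℕ} (hN : 1 ≤ N)
    {H : Ω → Matrix (Fin N) (Fin N) ℂ} {ν : Measure ℂ} {ν' : Measure ℝ} (hW : IsWignerMatrix P N H ν ν')
    {δ₀ D D' : ℝ} (hC : CondC1 ν ν' δ₀ D D') :
    ∃ μ : Idx N → Measure ℂ, Laws δ₀ (max (max D D') 1) N μ ∧ ∀ E L : ℝ,
      P {ω | gapEv (hW.herm ω) E L} ≤ Measure.pi μ {y | gapEv (Hm_herm y) E L} := by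
  have := hW.prob
  have := hW.probν
  have := hW.probν'
  have hs : (0:ℝ) < Real.sqrt N := by
    have : (0:ℝ) < N := by exact_mod_cast hN
    positivity
  set X : Idx N → Ω → ℂ := fun p ω => (Real.sqrt N : ℂ) * H ω p.1.1 p.1.2 with hX
  have hdr : ∀ ω i, H ω i i = ((H ω i i).re : ℂ) := fun ω i => by
    apply Complex.ext
    · simp
    · simp [hW.diag_real ω i]
  have hdm : ∀ i, AEMeasurable (fun ω => Real.sqrt N * (H ω i i).re) P := fun i =>
    aemeasurable_of_map_neZero (by rw [hW.diag i]; infer_instance)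
  have hdX : ∀ i (h : i ≤ i), X ⟨(i, i), h⟩ = (fun x : ℝ => (x : ℂ)) ∘ fun ω => Real.sqrt N * (H ω i i).re := by
    intro i h
    funext ω
    simp only [hX, Function.comp]
    rw [hdr ω i]; push_cast; simp
  have mc : Measurable (fun x : ℝ => (x : ℂ)) := by fun_prop
  have hlaw : ∀ i j (h : i ≤ j), i < j → P.map (X ⟨(i, j), h⟩) = ν := fun i j _ h => hW.offdiag i j h
  have hlawd : ∀ i (h : i ≤ i), P.map (X ⟨(i, i), h⟩) = ν'.map (fun x : ℝ => (x : ℂ)) := by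
    intro i h
    rw [hdX, ← AEMeasurable.map_map_of_aemeasurable mc.aemeasurable (hdm i), hW.diag i]
  have hXm : ∀ p, AEMeasurable (X p) P := by
    rintro ⟨⟨i, j⟩, h⟩
    rcases lt_or_eq_of_le h with h1 | h1
    · exact aemeasurable_of_map_neZero (by rw [hlaw i j h h1]; infer_instance)
    · simp only at h1
      subst h1
      rw [hdX]
      exact mc.comp_aemeasurable (hdm i)
  have hind : iIndepFun X P :=
    hW.indep.comp (fun _ z => (Real.sqrt N : ℂ) * z) (fun _ => by fun_prop)
  have hmap := (iIndepFun_iff_map_fun_eq_pi_map hXm).1 hind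
  have hHm : ∀ ω, H ω = Hm (fun p => X p ω) := by
    intro ω
    have hsc : (Real.sqrt N : ℂ) ≠ 0 := by exact_mod_cast hs.ne'
    ext i j
    unfold Hm
    rcases lt_trichotomy i j with h | h | h
    · rw [dif_pos h]
      simp only [hX]
      push_cast; field_simp
    · subst h
      rw [dif_neg (lt_irrefl _), dif_neg (lt_irrefl _)]
      simp only [hX]
      rw [Complex.re_ofReal_mul]
      conv_lhs => rw [hdr ω i]
      push_cast; field_simp
    · rw [dif_neg (not_lt.2 h.le), dif_pos h]
      simp only [hX]
      have := (hW.herm ω).apply i j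
      rw [map_mul, Complex.conj_ofReal]
      rw [← this]
      push_cast
      rw [← mul_assoc, inv_mul_cancel₀ hsc, one_mul]; rfl
  obtain ⟨hδ, hC1, hC2⟩ := hC
  refine ⟨fun p => P.map (X p), ⟨?_, ?_⟩, ?_⟩
  · rintro ⟨⟨i, j⟩, h⟩
    rcases lt_or_eq_of_le h with h1 | h1
    · rw [hlaw i j h h1]
      exact ⟨inferInstance, hW.mean, hC1.trans (ENNReal.ofReal_le_ofReal ((le_max_left _ _).trans (le_max_left _ _)))⟩
    · simp only at h1
      subst h1
      rw [hlawd]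
      exact SubG.ofR hW.mean' (hC2.trans (ENNReal.ofReal_le_ofReal ((le_max_right _ _).trans (le_max_left _ _))))
  · rintro ⟨⟨i, j⟩, h⟩ hne
    rw [hlaw i j h (lt_of_le_of_ne h hne)]
    exact hW.var
  · intro E L
    rw [← hmap]
    refine le_trans (measure_mono ?_) (Measure.le_map_apply (aemeasurable_pi_lambda _ hXm) _)
    intro ω hω
    have key : ∀ (A B : Matrix (Fin N) (Fin N) ℂ) (hA : A.IsHermitian) (hB : B.IsHermitian), A = B →
        gapEv hA E L → gapEv hB E L := by
      intro A B hA hB hAB h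
      subst hAB
      exact h
    exact key _ _ _ _ (hHm ω) hω

end WG

/-- **Tail bound for the eigenvalue gap.** The event below states that some eigenvalue lies
below `E`, some eigenvalue lies at or above `E` (i.e. the largest eigenvalue `λ_α` below `E`
is not the top one, `α ≤ N-1`), and the next eigenvalue `λ_{α+1}` (the smallest one `≥ E`)
satisfies `λ_{α+1} - E ≥ K/N`. -/
theorem stmt_5 :
    ∀ κ δ₀ D D' : ℝ, 0 < κ →
    ∃ C c : ℝ, 0 < C ∧ 0 < c ∧
    ∀ (N : ℕ) (Ω : Type) (_ : MeasurableSpace Ω) (P : Measure Ω)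
      (H : Ω → Matrix (Fin N) (Fin N) ℂ) (ν : Measure ℂ) (ν' : Measure ℝ),
      1 ≤ N →
      ∀ (hW : IsWignerMatrix P N H ν ν'),
      CondC1 ν ν' δ₀ D D' →
      ∀ E : ℝ, E ∈ Set.Icc (-2 + κ) (2 - κ) →
      ∀ K : ℝ, 0 ≤ K →
        P {ω | (∃ i, (hW.herm ω).eigenvalues i < E) ∧
               (∃ i, E ≤ (hW.herm ω).eigenvalues i) ∧
               (∀ i, E ≤ (hW.herm ω).eigenvalues i → E + K / N ≤ (hW.herm ω).eigenvalues i)}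
          ≤ ENNReal.ofReal (C * Real.exp (-(c * Real.sqrt K))) := by
  intro κ δ₀ D D' hκ
  by_cases hδ : 0 < δ₀
  · obtain ⟨C, c, hC, hc, M⟩ := WG.canon hκ hδ (le_max_right (max D D') 1)
    refine ⟨C, c, hC, hc, ?_⟩
    intro N Ω _ P H ν ν' hN hW hC1 E hE K hK
    obtain ⟨μ, hμ, hle⟩ := WG.transfer hN hW hC1
    obtain ⟨n, rfl⟩ : ∃ n, N = n + 1 := ⟨N - 1, by omega⟩
    refine (hle E (K / ((n + 1 : ℕ) : ℝ))).trans ?_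
    have := M n μ hμ E hE K hK
    push_cast
    exact this
  · refine ⟨1, 1, one_pos, one_pos, ?_⟩
    intro N Ω _ P H ν ν' hN hW hC1
    exact absurd hC1.1 hδ

end
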